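/- arXiv:1304.0571 — 4 statements merged into one kernel-verified Lean document; each statement's English description precedes it below -/
import Mathlib

section
/- For every natural number n, 𝓑_n ⊆ 𝓦_n* ∩ 𝓑_n*. That is, if ξ ∈ ℝ satisfies |P(ξ)| ≥ c₁ H(P)^{−n} for some c₁ > 0 and all nonzero integer polynomials P of degree at most n, then there exists c₃ > 0 with |ξ − α| ≥ c₃ H(α)^{−n−1} for all real algebraic α of degree ≤ n, and there exists c₂ > 0 such that |ξ − α| < c₂ H(α)^{−n−1} for infinitely many real algebraic α of degree ≤ n. -/
/-- The (naive) height of an integer polynomial: the maximum of the absolute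
values of its coefficients. -/
def polyHeight (P : Polynomial ℤ) : ℕ := P.support.sup fun i => (P.coeff i).natAbs

/-- `α : ℝ` is a real algebraic number of degree at most `n`. -/
def IsAlgDegLe (n : ℕ) (α : ℝ) : Prop :=
  ∃ P : Polynomial ℤ, P ≠ 0 ∧ Polynomial.aeval α P = 0 ∧ P.natDegree ≤ n

/-- The (naive) height of a real algebraic number: the minimum of `polyHeight P`
over all nonzero integer polynomials `P` vanishing at `α`. -/
noncomputable def algHeight (α : ℝ) : ℕ :=
  sInf {h | ∃ P : Polynomial ℤ, P ≠ 0 ∧ Polynomial.aeval α P = 0 ∧ polyHeight P = h}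

/-- The set `𝓑_n` of reals badly approximable by integer polynomials of degree `≤ n`. -/
def BsetB (n : ℕ) : Set ℝ :=
  {ξ | ∃ c : ℝ, 0 < c ∧ ∀ P : Polynomial ℤ, P ≠ 0 → P.natDegree ≤ n →
    c / (polyHeight P : ℝ) ^ n ≤ |Polynomial.aeval ξ P|}

/-- The set `𝓦_n*` of reals very well approximable by algebraic numbers of degree `≤ n`. -/
def WstarSet (n : ℕ) : Set ℝ :=
  {ξ | ∃ c : ℝ, 0 < c ∧
    {α : ℝ | IsAlgDegLe n α ∧ |ξ - α| < c / (algHeight α : ℝ) ^ (n + 1)}.Infinite}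

/-- The set `𝓑_n*` of reals badly approximable by algebraic numbers of degree `≤ n`. -/
def BstarSet (n : ℕ) : Set ℝ :=
  {ξ | ∃ c : ℝ, 0 < c ∧ ∀ α : ℝ, IsAlgDegLe n α →
    c / (algHeight α : ℝ) ^ (n + 1) ≤ |ξ - α|}

open Polynomial

lemma coeff_le_polyHeight (P : ℤ[X]) (i : ℕ) : |((P.coeff i : ℤ) : ℝ)| ≤ polyHeight P := by
  by_cases h : i ∈ P.support
  · have := Finset.le_sup (f := fun i => (P.coeff i).natAbs) h
    have h2 : (((P.coeff i).natAbs : ℕ) : ℝ) ≤ polyHeight P := by exact_mod_cast this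
    rwa [Nat.cast_natAbs, Int.cast_abs] at h2
  · rw [notMem_support_iff.1 h]; simp

lemma polyHeight_le (P : ℤ[X]) (T : ℝ) (hT : 0 ≤ T) (h : ∀ i, |((P.coeff i : ℤ) : ℝ)| ≤ T) :
    (polyHeight P : ℝ) ≤ T := by
  have : polyHeight P ≤ ⌊T⌋₊ := by
    refine Finset.sup_le fun i _ => Nat.le_floor ?_
    rw [Nat.cast_natAbs, Int.cast_abs]
    exact h i
  exact (Nat.cast_le.2 this).trans (Nat.floor_le hT)

lemma one_le_polyHeight (P : ℤ[X]) (h : P ≠ 0) : (1 : ℝ) ≤ polyHeight P := by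
  refine le_trans ?_ (coeff_le_polyHeight P P.natDegree)
  have : P.coeff P.natDegree ≠ 0 := by simpa using h
  exact_mod_cast Int.one_le_abs this

lemma algHeight_le (α : ℝ) (P : ℤ[X]) (h : P ≠ 0) (h0 : aeval α P = 0) :
    algHeight α ≤ polyHeight P := Nat.sInf_le ⟨P, h, h0, rfl⟩

lemma algHeight_spec (α : ℝ) (n : ℕ) (h : IsAlgDegLe n α) :
    ∃ P : ℤ[X], P ≠ 0 ∧ aeval α P = 0 ∧ polyHeight P = algHeight α := by
  obtain ⟨P, h, h0, -⟩ := h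
  exact Nat.sInf_mem (s := {h | ∃ P : Polynomial ℤ, P ≠ 0 ∧ Polynomial.aeval α P = 0 ∧ polyHeight P = h}) ⟨_, P, h, h0, rfl⟩

lemma exists_int_minpoly (α : ℝ) (R : ℤ[X]) (hR : R ≠ 0) (h0 : aeval α R = 0) :
    ∃ f : ℤ[X], f ≠ 0 ∧ aeval α f = 0 ∧ ∀ P : ℤ[X], aeval α P = 0 → f ∣ P := by
  have hex : ∃ R : ℤ[X], Irreducible R ∧ aeval α R = 0 := by
    revert h0
    induction R using UniqueFactorizationMonoid.induction_on_prime with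
    | h₁ => exact absurd rfl hR
    | h₂ x hx =>
      intro h0
      exact absurd (hx.map (aeval α)) (by simp [h0])
    | h₃ a p ha hp ih =>
      intro h0
      rw [map_mul, mul_eq_zero] at h0
      rcases h0 with h | h
      · exact ⟨p, hp.irreducible, h⟩
      · exact ih ha h
  obtain ⟨f, hf, hf0⟩ := hex
  refine ⟨f, hf.ne_zero, hf0, fun P hP => ?_⟩
  have hdeg : f.natDegree ≠ 0 := by
    intro h
    rw [natDegree_eq_zero] at h
    obtain ⟨c, rfl⟩ := h
    simp at hf0
    exact hf.ne_zero (by simp [hf0])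
  have hprim := hf.isPrimitive hdeg
  rw [IsPrimitive.Int.dvd_iff_map_cast_dvd_map_cast _ _ hprim]
  have hirr := (IsPrimitive.Int.irreducible_iff_irreducible_map_cast hprim).1 hf
  have e : ∀ Q : ℤ[X], aeval α (Q.map (Int.castRingHom ℚ)) = aeval α Q := by
    intro Q
    exact aeval_map_algebraMap ℚ α Q
  have h1 : minpoly ℚ α ∣ f.map (Int.castRingHom ℚ) := minpoly.dvd _ _ (by rw [e, hf0])
  have h2 : minpoly ℚ α ∣ P.map (Int.castRingHom ℚ) := minpoly.dvd _ _ (by rw [e, hP])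
  refine dvd_trans ?_ h2
  refine (hirr.dvd_iff.1 h1).resolve_left ?_ |>.dvd
  exact minpoly.not_isUnit _ _

noncomputable def half (P : ℤ[X]) : ℂ[X] := (P.map (Int.castRingHom ℂ)).comp (C (1/2) * X)

lemma half_coeff (P : ℤ[X]) (i : ℕ) : (half P).coeff i = (P.coeff i : ℂ) * (1/2)^i := by
  rw [half, comp_C_mul_X_coeff]; simp

lemma half_mahler (P : ℤ[X]) (T : ℝ) (hT : 0 ≤ T) (h : ∀ i, |((P.coeff i : ℤ) : ℝ)| ≤ T) :
    (half P).mahlerMeasure ≤ 2 * T := by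
  refine (mahlerMeasure_le_sum_norm_coeff _).trans ?_
  rw [sum_def]
  have : ∀ i ∈ (half P).support, ‖(half P).coeff i‖ ≤ T * (1/2)^i := by
    intro i _
    rw [half_coeff, norm_mul, norm_pow]
    have : ‖((P.coeff i : ℤ) : ℂ)‖ = |((P.coeff i : ℤ) : ℝ)| := by simp
    rw [this]
    have h2 : ‖(1/2 : ℂ)‖ = 1/2 := by simp
    rw [h2]
    gcongr
    exact h i
  refine (Finset.sum_le_sum this).trans ?_
  rw [← Finset.mul_sum, mul_comm]
  gcongr
  have := Summable.sum_le_tsum (f := fun i : ℕ => (1/2 : ℝ)^i) (half P).support (fun i _ => by positivity) summable_geometric_two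
  rwa [tsum_geometric_two] at this

lemma factor_bound0 (n : ℕ) (f g : ℤ[X]) (hf : f.natDegree ≤ n) (hg : g.coeff 0 ≠ 0)
    (T : ℝ) (hT : 0 ≤ T) (h : ∀ i, |(((f * g).coeff i : ℤ) : ℝ)| ≤ T) (i : ℕ) :
    |((f.coeff i : ℤ) : ℝ)| ≤ 2 * 4 ^ n * T := by
  have h1 := half_mahler _ T hT h
  have e : half (f * g) = half f * half g := by simp [half]
  rw [e, mahlerMeasure_mul] at h1
  have h2 : 1 ≤ (half g).mahlerMeasure := by
    have := norm_coeff_le_choose_mul_mahlerMeasure 0 (half g)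
    rw [half_coeff] at this
    simp at this
    refine le_trans ?_ this
    exact_mod_cast Int.one_le_abs hg
  have h3 : (half f).mahlerMeasure ≤ 2 * T :=
    (le_mul_of_one_le_right (mahlerMeasure_nonneg _) h2).trans h1
  by_cases hi : n < i
  · rw [coeff_eq_zero_of_natDegree_lt (by omega)]; simp; positivity
  push Not at hi
  have h4 := norm_coeff_le_choose_mul_mahlerMeasure i (half f)
  have hd : (half f).natDegree ≤ n := by
    rw [natDegree_le_iff_coeff_eq_zero]
    intro k hk
    rw [half_coeff, coeff_eq_zero_of_natDegree_lt (by omega)]; simp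
  have h5 : (((half f).natDegree.choose i : ℕ) : ℝ) ≤ 2 ^ n := by
    have h6 := (Nat.choose_le_two_pow (half f).natDegree i).trans (Nat.pow_le_pow_right (by norm_num) hd)
    exact_mod_cast h6
  have h6 : ‖(half f).coeff i‖ = |((f.coeff i : ℤ) : ℝ)| * (1/2)^i := by
    rw [half_coeff, norm_mul, norm_pow]; simp
  rw [h6] at h4
  have h7 : |((f.coeff i : ℤ) : ℝ)| * (1/2)^n ≤ 2^n * (2 * T) := by
    calc _ ≤ |((f.coeff i : ℤ) : ℝ)| * (1/2)^i := by
          gcongr ?_ * ?_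
          exact pow_le_pow_of_le_one (by norm_num) (by norm_num) hi
      _ ≤ _ := h4
      _ ≤ _ := by
        gcongr
        exact mahlerMeasure_nonneg _
  have h8 : |((f.coeff i : ℤ) : ℝ)| = |((f.coeff i : ℤ) : ℝ)| * (1/2)^n * 2^n := by
    rw [mul_assoc, ← mul_pow]; norm_num
  rw [h8]
  calc _ ≤ 2^n * (2 * T) * 2 ^ n := by gcongr
    _ = 2 * (2^n * 2^n) * T := by ring
    _ = _ := by rw [← mul_pow]; norm_num

lemma factor_bound (n : ℕ) (f g : ℤ[X]) (hf : f.natDegree ≤ n) (hg : g ≠ 0)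
    (T : ℝ) (hT : 0 ≤ T) (h : ∀ i, |(((f * g).coeff i : ℤ) : ℝ)| ≤ T) (i : ℕ) :
    |((f.coeff i : ℤ) : ℝ)| ≤ 2 * 4 ^ n * T := by
  obtain ⟨q, hq, hX⟩ := exists_eq_pow_rootMultiplicity_mul_and_not_dvd g hg 0
  simp only [map_zero, sub_zero] at hq hX
  rw [X_dvd_iff] at hX
  refine factor_bound0 n f q hf hX T hT (fun j => ?_) i
  have := h (j + g.rootMultiplicity 0)
  have e : f * g = (f * q) * X ^ (g.rootMultiplicity 0) := by
    conv_lhs => rw [hq]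
    ring
  rwa [e, coeff_mul_X_pow] at this

/-- A polynomial of degree at most `n` vanishing at `α` with height comparable to that of `α`. -/
lemma exists_good_poly (n : ℕ) (α : ℝ) (h : IsAlgDegLe n α) :
    ∃ f : ℤ[X], f ≠ 0 ∧ f.natDegree ≤ n ∧ aeval α f = 0 ∧
      (polyHeight f : ℝ) ≤ 2 * 4 ^ n * algHeight α := by
  obtain ⟨P, hP, hP0, hPH⟩ := algHeight_spec α n h
  obtain ⟨R, hR, hR0, hRn⟩ := h
  obtain ⟨f, hf, hf0, hdvd⟩ := exists_int_minpoly α R hR hR0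
  have hfn : f.natDegree ≤ n := (natDegree_le_of_dvd (hdvd R hR0) hR).trans hRn
  refine ⟨f, hf, hfn, hf0, ?_⟩
  obtain ⟨g, rfl⟩ := hdvd P hP0
  refine polyHeight_le _ _ (by positivity) fun i => ?_
  refine factor_bound n f g hfn (right_ne_zero_of_mul hP) _ (by positivity) (fun j => ?_) i
  rw [← hPH]
  exact coeff_le_polyHeight _ j

lemma aeval_sum (n : ℕ) (P : ℤ[X]) (hP : P.natDegree ≤ n) (x : ℝ) :
    aeval x P = ∑ i ∈ Finset.range (n+1), (P.coeff i : ℝ) * x ^ i := by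
  rw [aeval_eq_sum_range' (Nat.lt_succ_of_le hP)]
  simp

lemma aeval_deriv_sum (n : ℕ) (P : ℤ[X]) (hP : P.natDegree ≤ n) (x : ℝ) :
    aeval x (derivative P) = ∑ i ∈ Finset.range (n+1), (P.coeff i : ℝ) * (i * x ^ (i-1)) := by
  conv_lhs => rw [as_sum_range' P (n+1) (Nat.lt_succ_of_le hP)]
  rw [derivative_sum, map_sum]
  refine Finset.sum_congr rfl fun i _ => ?_
  rw [derivative_monomial, aeval_monomial]
  simp
  ring

lemma pow_taylor (x : ℝ) (i : ℕ) : ∃ e : ℝ, 0 ≤ e ∧ ∀ t : ℝ, |t| ≤ 1 →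
    |(x + t)^i - x^i - i * x^(i-1) * t| ≤ e * t^2 := by
  induction i with
  | zero => exact ⟨0, le_rfl, fun t _ => by simp⟩
  | succ i ih =>
    obtain ⟨e, he, h⟩ := ih
    refine ⟨(|x| + 1) * e + |i * x^(i-1)|, by positivity, fun t ht => ?_⟩
    have hx : (i : ℝ) * x ^ (i-1) * x = i * x^i := by
      rcases i with _ | i
      · simp
      · simp [pow_succ]; ring
    have e1 : (x + t)^(i+1) - x^(i+1) - ((i+1 : ℕ) : ℝ) * x^(i+1-1) * t
        = (x + t) * ((x + t)^i - x^i - i * x^(i-1) * t) + (i * x^(i-1)) * t^2 := by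
      push_cast
      linear_combination t * hx
    rw [e1]
    refine (abs_add_le _ _).trans ?_
    rw [abs_mul, abs_mul, abs_of_nonneg (sq_nonneg t), add_mul]
    have h1 : |x + t| ≤ |x| + 1 := (abs_add_le _ _).trans (by gcongr)
    have h2 := h t ht
    rw [mul_assoc (|x| + 1)]
    gcongr

lemma poly_taylor (n : ℕ) (x : ℝ) : ∃ E : ℝ, 0 < E ∧ ∀ (P : ℤ[X]) (T : ℝ), P.natDegree ≤ n →
    (∀ i, |((P.coeff i : ℤ) : ℝ)| ≤ T) → ∀ t : ℝ, |t| ≤ 1 →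
    |aeval (x + t) P - aeval x P - aeval x (derivative P) * t| ≤ E * T * t^2 := by
  choose e he h using pow_taylor x
  refine ⟨∑ i ∈ Finset.range (n+1), e i + 1, by
    have := Finset.sum_nonneg (s := Finset.range (n+1)) (fun i _ => he i); linarith, ?_⟩
  intro P T hP hT t ht
  have hT0 : 0 ≤ T := (abs_nonneg _).trans (hT 0)
  rw [aeval_sum n P hP, aeval_sum n P hP, aeval_deriv_sum n P hP, Finset.sum_mul,
    ← Finset.sum_sub_distrib, ← Finset.sum_sub_distrib]
  refine (Finset.abs_sum_le_sum_abs _ _).trans ?_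
  calc _ ≤ ∑ i ∈ Finset.range (n+1), T * (e i * t^2) := by
        refine Finset.sum_le_sum fun i _ => ?_
        have e1 : (P.coeff i : ℝ) * (x+t)^i - (P.coeff i : ℝ) * x^i - (P.coeff i : ℝ) * (i * x^(i-1)) * t
          = (P.coeff i : ℝ) * ((x + t)^i - x^i - i * x^(i-1) * t) := by ring
        rw [e1, abs_mul]
        have := h i t ht
        have := hT i
        gcongr
    _ = (∑ i ∈ Finset.range (n+1), e i) * T * t^2 := by
        rw [← Finset.mul_sum, ← Finset.sum_mul]; ring
    _ ≤ _ := by gcongr; linarith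

lemma deriv_bound (n : ℕ) (x : ℝ) : ∃ E : ℝ, 0 < E ∧ ∀ (P : ℤ[X]) (T : ℝ), P.natDegree ≤ n →
    (∀ i, |((P.coeff i : ℤ) : ℝ)| ≤ T) → |aeval x (derivative P)| ≤ E * T := by
  refine ⟨∑ i ∈ Finset.range (n+1), |(i : ℝ) * x^(i-1)| + 1, by positivity, ?_⟩
  intro P T hP hT
  have hT0 : 0 ≤ T := (abs_nonneg _).trans (hT 0)
  rw [aeval_deriv_sum n P hP]
  refine (Finset.abs_sum_le_sum_abs _ _).trans ?_
  calc _ ≤ ∑ i ∈ Finset.range (n+1), T * |(i : ℝ) * x^(i-1)| := by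
        refine Finset.sum_le_sum fun i _ => ?_
        rw [abs_mul]
        have := hT i
        gcongr
    _ = (∑ i ∈ Finset.range (n+1), |(i : ℝ) * x^(i-1)|) * T := by
        rw [← Finset.mul_sum]; ring
    _ ≤ _ := by gcongr; linarith

theorem Bstar_part (n : ℕ) : BsetB n ⊆ BstarSet n := by
  rintro ξ ⟨c, hc, hξ⟩
  obtain ⟨E, hE, hE2⟩ := poly_taylor n ξ
  obtain ⟨D, hD, hD2⟩ := deriv_bound n ξ
  set K : ℝ := 2 * 4 ^ n with hK
  have hK0 : 0 < K := by positivity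
  refine ⟨min 1 (c / ((E + D) * K^(n+1))), by positivity, fun α hα => ?_⟩
  obtain ⟨f, hf, hfn, hf0, hfH⟩ := exists_good_poly n α hα
  have hH1 := one_le_polyHeight f hf
  have hA : 1 ≤ (algHeight α : ℝ) := by
    obtain ⟨P, hP, -, hPH⟩ := algHeight_spec α n hα
    rw [← hPH]; exact one_le_polyHeight P hP
  by_cases h1 : 1 ≤ |ξ - α|
  · refine le_trans ?_ h1
    rw [div_le_one (by positivity)]
    exact (min_le_left _ _).trans (one_le_pow₀ hA)
  push Not at h1
  set t := α - ξ with ht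
  have htt : |ξ - α| = |t| := by rw [ht, abs_sub_comm]
  rw [htt] at h1 ⊢
  have h2 := hE2 f _ hfn (coeff_le_polyHeight f) t h1.le
  have h3 := hD2 f _ hfn (coeff_le_polyHeight f)
  have h4 := hξ f hf hfn
  have e : ξ + t = α := by rw [ht]; ring
  rw [e, hf0] at h2
  set H : ℝ := (polyHeight f : ℝ) with hH
  have h5 : |aeval ξ f| ≤ (E + D) * H * |t| := by
    have e2 : aeval ξ f = -((0 - aeval ξ f - aeval ξ (derivative f) * t) + aeval ξ (derivative f) * t) := by ring
    rw [e2, abs_neg]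
    refine (abs_add_le _ _).trans ?_
    rw [abs_mul (aeval ξ (derivative f))]
    have : t^2 ≤ |t| := by
      rw [← sq_abs]; nlinarith [abs_nonneg t]
    calc _ ≤ E * H * t^2 + D * H * |t| := by gcongr
      _ ≤ E * H * |t| + D * H * |t| := by gcongr
      _ = _ := by ring
  have h6 := h4.trans h5
  rw [div_le_iff₀ (by positivity)] at h6 ⊢
  calc _ ≤ c / ((E + D) * K^(n+1)) := min_le_right _ _
    _ ≤ _ := by
      rw [div_le_iff₀ (by positivity)]
      calc c ≤ _ := h6
        _ = (E + D) * |t| * H^(n+1) := by ring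
        _ ≤ (E + D) * |t| * (K * algHeight α)^(n+1) := by gcongr
        _ = _ := by rw [mul_pow]; ring

lemma recover_coeff (m : ℕ) (x : ℝ) : ∃ K : ℝ, 1 ≤ K ∧ ∀ (P : ℤ[X]) (T : ℝ), P.natDegree ≤ m + 1 →
    |aeval x P| ≤ T → |aeval x (derivative P)| ≤ T →
    (∀ i, |((P.coeff (i+2) : ℤ) : ℝ)| ≤ T) → ∀ i, |((P.coeff i : ℤ) : ℝ)| ≤ K * T := by
  set S1 : ℝ := ∑ i ∈ Finset.range m, |((i + 2 : ℕ) : ℝ) * x^(i+1)| with hS1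
  set S2 : ℝ := ∑ i ∈ Finset.range m, |x^(i+2)| with hS2
  have hS10 : 0 ≤ S1 := Finset.sum_nonneg fun _ _ => abs_nonneg _
  have hS20 : 0 ≤ S2 := Finset.sum_nonneg fun _ _ => abs_nonneg _
  refine ⟨1 + (1 + S1) + (1 + S1) * |x| + S2, by
    have : 0 ≤ (1 + S1) * |x| := by positivity
    linarith, ?_⟩
  intro P T hP h0 h1 h2
  have hT : 0 ≤ T := (abs_nonneg _).trans h0
  rw [aeval_sum _ P hP, Finset.sum_range_succ', Finset.sum_range_succ'] at h0
  rw [aeval_deriv_sum _ P hP, Finset.sum_range_succ', Finset.sum_range_succ'] at h1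
  simp only [zero_add, Nat.cast_zero, zero_mul, mul_zero, add_zero, Nat.cast_one,
    Nat.sub_self, pow_zero, mul_one, pow_one] at h0 h1
  have b1 : |∑ i ∈ Finset.range m, (P.coeff (i+1+1) : ℝ) * (((i+1+1 : ℕ) : ℝ) * x^(i+1+1-1))| ≤ S1 * T := by
    refine (Finset.abs_sum_le_sum_abs _ _).trans ?_
    rw [hS1, Finset.sum_mul]
    refine Finset.sum_le_sum fun i _ => ?_
    rw [abs_mul, mul_comm]
    have := h2 i
    gcongr ?_ * ?_
    exact le_rfl
  have b2 : |∑ i ∈ Finset.range m, (P.coeff (i+1+1) : ℝ) * x^(i+1+1)| ≤ S2 * T := by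
    refine (Finset.abs_sum_le_sum_abs _ _).trans ?_
    rw [hS2, Finset.sum_mul]
    refine Finset.sum_le_sum fun i _ => ?_
    rw [abs_mul, mul_comm]
    have := h2 i
    gcongr ?_ * ?_
  generalize (∑ i ∈ Finset.range m, (P.coeff (i+1+1) : ℝ) * (((i+1+1 : ℕ) : ℝ) * x^(i+1+1-1))) = U1 at *
  generalize (∑ i ∈ Finset.range m, (P.coeff (i+1+1) : ℝ) * x^(i+1+1)) = U2 at *
  have c1 : |(P.coeff 1 : ℝ)| ≤ (1 + S1) * T := by
    have e : (P.coeff 1 : ℝ) = (U1 + P.coeff 1) - U1 := by ring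
    rw [e]
    refine (abs_sub _ _).trans ?_
    linarith
  have c0 : |(P.coeff 0 : ℝ)| ≤ (1 + (1 + S1) * |x| + S2) * T := by
    have e : (P.coeff 0 : ℝ) = (U2 + P.coeff 1 * x + P.coeff 0) - U2 - P.coeff 1 * x := by ring
    rw [e]
    refine (abs_sub _ _).trans ?_
    have := abs_sub (U2 + P.coeff 1 * x + P.coeff 0) U2
    have h3 : |(P.coeff 1 : ℝ) * x| ≤ (1 + S1) * T * |x| := by rw [abs_mul]; gcongr
    linarith
  intro i
  have p1 : 0 ≤ S1 * T := by positivity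
  have p2 : 0 ≤ S2 * T := by positivity
  have p3 : 0 ≤ (1 + S1) * |x| * T := by positivity
  rcases i with _ | _ | i
  · linarith
  · simp only [zero_add]; linarith
  · have := h2 i
    linarith

noncomputable def boxW (m Q : ℕ) (v : Fin m → Fin Q) : ℤ[X] :=
  ofFn m (fun j => ((v j : ℕ) : ℤ))

noncomputable def boxA1 (ξ : ℝ) (m Q N : ℕ) (p : (Fin m → Fin Q) × Fin N) : ℤ :=
  ((p.2 : ℕ) : ℤ) - ⌊aeval ξ (derivative (boxW m Q p.1 * X * X))⌋

noncomputable def boxG (ξ : ℝ) (m Q N : ℕ) (p : (Fin m → Fin Q) × Fin N) : ℤ[X] :=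
  (boxW m Q p.1 * X + C (boxA1 ξ m Q N p)) * X +
    C (-⌊aeval ξ ((boxW m Q p.1 * X + C (boxA1 ξ m Q N p)) * X)⌋)

lemma boxG_eval (ξ : ℝ) (m Q N : ℕ) (p : (Fin m → Fin Q) × Fin N) :
    0 ≤ aeval ξ (boxG ξ m Q N p) ∧ aeval ξ (boxG ξ m Q N p) < 1 := by
  rw [boxG, map_add, aeval_C]
  generalize aeval ξ ((boxW m Q p.1 * X + C (boxA1 ξ m Q N p)) * X) = y
  have : y + (algebraMap ℤ ℝ) (-⌊y⌋) = Int.fract y := by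
    rw [← Int.self_sub_floor]; simp only [eq_intCast]; push_cast; ring
  rw [this]
  exact ⟨Int.fract_nonneg _, Int.fract_lt_one _⟩

lemma boxG_deriv (ξ : ℝ) (m Q N : ℕ) (p : (Fin m → Fin Q) × Fin N) :
    ((p.2 : ℕ) : ℝ) ≤ aeval ξ (derivative (boxG ξ m Q N p)) ∧
      aeval ξ (derivative (boxG ξ m Q N p)) < (p.2 : ℕ) + 1 := by
  have e : derivative (boxG ξ m Q N p) =
      derivative (boxW m Q p.1 * X * X) + C (boxA1 ξ m Q N p) := by
    rw [boxG, add_mul, derivative_add, derivative_add, derivative_C, derivative_C_mul_X, add_zero]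
  rw [e, map_add, aeval_C, boxA1]
  generalize aeval ξ (derivative (boxW m Q p.1 * X * X)) = y
  have : y + (algebraMap ℤ ℝ) ((p.2 : ℕ) - ⌊y⌋) = (p.2 : ℕ) + Int.fract y := by
    rw [← Int.self_sub_floor]; simp only [eq_intCast]; push_cast; ring
  rw [this]
  have := Int.fract_nonneg y
  have := Int.fract_lt_one y
  constructor <;> linarith

lemma boxG_coeff_add_two (ξ : ℝ) (m Q N : ℕ) (p : (Fin m → Fin Q) × Fin N) (j : ℕ) :
    (boxG ξ m Q N p).coeff (j + 2) = (boxW m Q p.1).coeff j := by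
  rw [boxG, coeff_add, coeff_mul_X, coeff_add, coeff_mul_X, coeff_C_succ, coeff_C_succ, add_zero, add_zero]

lemma boxG_coeff_one (ξ : ℝ) (m Q N : ℕ) (p : (Fin m → Fin Q) × Fin N) :
    (boxG ξ m Q N p).coeff 1 = boxA1 ξ m Q N p := by
  have : (1 : ℕ) = 0 + 1 := rfl
  rw [boxG, coeff_add, this, coeff_mul_X, coeff_add, coeff_C_succ, mul_coeff_zero, coeff_X_zero, mul_zero,
    coeff_C_zero, zero_add, add_zero]

lemma boxW_coeff (m Q : ℕ) (hQ : 1 ≤ Q) (v : Fin m → Fin Q) (j : ℕ) :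
    0 ≤ (boxW m Q v).coeff j ∧ (boxW m Q v).coeff j < Q := by
  rw [boxW]
  by_cases h : j < m
  · rw [ofFn_coeff_eq_val_of_lt _ h]
    constructor
    · positivity
    · exact_mod_cast (v ⟨j, h⟩).2
  · rw [ofFn_coeff_eq_zero_of_ge _ (by omega)]
    constructor <;> omega

lemma boxG_inj (ξ : ℝ) (m Q N : ℕ) : Function.Injective (boxG ξ m Q N) := by
  intro p q h
  have hv : p.1 = q.1 := by
    funext j
    have h1 := boxG_coeff_add_two ξ m Q N p j
    have h2 := boxG_coeff_add_two ξ m Q N q j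
    rw [h, h2, boxW, boxW, ofFn_coeff_eq_val_of_lt _ j.2, ofFn_coeff_eq_val_of_lt _ j.2] at h1
    apply Fin.ext
    exact_mod_cast h1.symm
  have hk : p.2 = q.2 := by
    have h1 := boxG_coeff_one ξ m Q N p
    have h2 := boxG_coeff_one ξ m Q N q
    rw [h, h2, boxA1, boxA1, hv] at h1
    apply Fin.ext
    omega
  exact Prod.ext hv hk

lemma box_principle (ξ : ℝ) (m B M Q : ℕ) (hB : 1 ≤ B) (hM : B < M) (hQ : 1 ≤ Q) :
    ∃ P : ℤ[X], P ≠ 0 ∧ P.natDegree ≤ m + 1 ∧ |aeval ξ P| < 1 / (B * (Q : ℝ)^(m+1)) ∧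
      |aeval ξ (derivative P)| ≤ M * Q ∧ ∀ i, |((P.coeff (i+2) : ℤ) : ℝ)| ≤ Q := by
  have hNpos : 0 < B * Q^(m+1) := by positivity
  have hNR : (0 : ℝ) < ((B * Q^(m+1) : ℕ) : ℝ) := by exact_mod_cast hNpos
  let φ : (Fin m → Fin Q) × Fin (M * Q) → Fin (B * Q^(m+1)) := fun p =>
    ⟨⌊aeval ξ (boxG ξ m Q _ p) * ((B * Q^(m+1) : ℕ) : ℝ)⌋₊, by
      have := boxG_eval ξ m Q _ p
      rw [Nat.floor_lt (by have := this.1; positivity)]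
      have := this.2
      nlinarith⟩
  obtain ⟨p, q, hne, hpq⟩ := Fintype.exists_ne_map_eq_of_card_lt φ (by
    simp only [Fintype.card_fin, Fintype.card_prod, Fintype.card_fun]
    calc B * Q^(m+1) < M * Q^(m+1) := by gcongr
      _ = _ := by ring)
  have hcoef : ∀ i, (boxG ξ m Q _ p - boxG ξ m Q _ q).coeff (i+2) = (boxW m Q p.1).coeff i - (boxW m Q q.1).coeff i := by
    intro i
    rw [coeff_sub, boxG_coeff_add_two, boxG_coeff_add_two]
  refine ⟨boxG ξ m Q _ p - boxG ξ m Q _ q, ?_, ?_, ?_, ?_, ?_⟩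
  · rw [sub_ne_zero]; exact fun h => hne (boxG_inj _ _ _ _ h)
  · rw [natDegree_le_iff_coeff_eq_zero]
    intro k hk
    obtain ⟨i, rfl⟩ := Nat.exists_eq_add_of_le' (show 2 ≤ k by omega)
    rw [hcoef, boxW, boxW, ofFn_coeff_eq_zero_of_ge _ (by omega), ofFn_coeff_eq_zero_of_ge _ (by omega), sub_zero]
  · have h1 := boxG_eval ξ m Q _ p
    have h2 := boxG_eval ξ m Q _ q
    have h3 := congrArg Fin.val hpq
    simp only [φ] at h3
    clear hpq
    clear φ
    rw [map_sub]
    generalize aeval ξ (boxG ξ m Q _ p) = y at *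
    generalize aeval ξ (boxG ξ m Q _ q) = z at *
    have hy := Nat.floor_le (mul_nonneg h1.1 hNR.le)
    have hy2 := Nat.lt_floor_add_one (y * ((B * Q^(m+1) : ℕ) : ℝ))
    have hz := Nat.floor_le (mul_nonneg h2.1 hNR.le)
    have hz2 := Nat.lt_floor_add_one (z * ((B * Q^(m+1) : ℕ) : ℝ))
    rw [h3] at hy hy2
    have e : (B * (Q : ℝ)^(m+1)) = ((B * Q^(m+1) : ℕ) : ℝ) := by push_cast; ring
    rw [e, lt_div_iff₀ hNR]
    generalize ((B * Q^(m+1) : ℕ) : ℝ) = N at *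
    have : |y - z| * N = |y * N - z * N| := by
      rw [← sub_mul, abs_mul, abs_of_pos hNR]
    rw [this, abs_lt]
    constructor <;> linarith
  · have h1 := boxG_deriv ξ m Q _ p
    have h2 := boxG_deriv ξ m Q _ q
    have h3 : ((p.2 : ℕ) : ℝ) + 1 ≤ M * Q := by exact_mod_cast p.2.2
    have h4 : ((q.2 : ℕ) : ℝ) + 1 ≤ M * Q := by exact_mod_cast q.2.2
    have h5 : (0 : ℝ) ≤ ((p.2 : ℕ) : ℝ) := by positivity
    have h6 : (0 : ℝ) ≤ ((q.2 : ℕ) : ℝ) := by positivity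
    rw [derivative_sub, map_sub, abs_le]
    constructor <;> linarith [h1.1, h1.2, h2.1, h2.2]
  · intro i
    rw [hcoef]
    have h1 := boxW_coeff m Q hQ p.1 i
    have h2 := boxW_coeff m Q hQ q.1 i
    have : |(boxW m Q p.1).coeff i - (boxW m Q q.1).coeff i| ≤ Q := by
      rw [abs_le]; constructor <;> linarith [h1.1, h1.2, h2.1, h2.2]
    exact_mod_cast this

theorem Wstar_part (m : ℕ) : BsetB (m+1) ⊆ WstarSet (m+1) := by
  rintro ξ ⟨c, hc, hξ⟩
  obtain ⟨K, hK, hK2⟩ := recover_coeff m ξ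
  obtain ⟨E, hE, hE2⟩ := poly_taylor (m+1) ξ
  have hK0 : 0 < K := by linarith
  obtain ⟨B0, hB0⟩ := exists_nat_gt (K^(m+1) / c)
  obtain ⟨B, hBdef⟩ : ∃ B, B = B0 + 1 := ⟨_, rfl⟩
  have hB1 : (1 : ℝ) ≤ B := by rw [hBdef]; push_cast; linarith [Nat.cast_nonneg (α := ℝ) B0]
  have hB : K^(m+1) / c < B := by rw [hBdef]; push_cast; linarith
  rw [div_lt_iff₀ hc] at hB
  set L : ℝ := K * ((B + 1 : ℕ) : ℝ) with hL
  have hL0 : 0 < L := by positivity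
  -- the key step
  have key : ∀ Q : ℕ, 1 ≤ Q → 4 * E * L ≤ Q → (2 : ℝ) ≤ Q → ∃ α : ℝ,
      IsAlgDegLe (m+1) α ∧ |ξ - α| ≤ 2 / (Q : ℝ)^(m+2) ∧ (algHeight α : ℝ) ≤ L * Q ∧
        1 ≤ (algHeight α : ℝ) := by
    intro Q hQ hQ2 hQ3
    have hQ0 : (0 : ℝ) < Q := by linarith
    have hQ1 : (1 : ℝ) ≤ Q := by linarith
    obtain ⟨P, hP, hPn, hPξ, hPd, hPc⟩ := box_principle ξ m B (B+1) Q (by omega) (by omega) hQ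
    have hPξ2 : |aeval ξ P| < 1 / (Q : ℝ)^(m+1) := by
      refine hPξ.trans_le ?_
      gcongr
      exact le_mul_of_one_le_left (by positivity) hB1
    have hone : 1 / (Q : ℝ)^(m+1) ≤ 1 := by
      rw [div_le_one (by positivity)]; exact one_le_pow₀ hQ1
    have hBig : (Q : ℝ) ≤ ((B + 1 : ℕ) : ℝ) * Q :=
      le_mul_of_one_le_left hQ0.le (by push_cast; linarith)
    have hcoef : ∀ i, |((P.coeff i : ℤ) : ℝ)| ≤ L * Q := by
      intro i
      rw [hL, mul_assoc]
      exact hK2 P _ hPn (by linarith) hPd (fun i => (hPc i).trans hBig) i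
    have hPH : (polyHeight P : ℝ) ≤ L * Q := polyHeight_le P _ (by positivity) hcoef
    have hder : (Q : ℝ) ≤ |aeval ξ (derivative P)| := by
      by_contra hcon
      push Not at hcon
      have h1 : (polyHeight P : ℝ) ≤ K * Q := polyHeight_le P _ (by positivity)
        (hK2 P _ hPn (by linarith) hcon.le hPc)
      have h2 := (hξ P hP hPn).trans_lt hPξ
      have hH1 := one_le_polyHeight P hP
      rw [div_lt_div_iff₀ (by positivity) (by positivity)] at h2
      have h3 : (polyHeight P : ℝ)^(m+1) ≤ K^(m+1) * (Q : ℝ)^(m+1) := by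
        rw [← mul_pow]; gcongr
      have h4 : K^(m+1) * (Q : ℝ)^(m+1) < B * c * (Q : ℝ)^(m+1) := by gcongr
      linarith
    set s : ℝ := 2 / (Q : ℝ)^(m+2) with hs
    have hs0 : 0 < s := by positivity
    have hs1 : s ≤ 1 := by
      rw [hs, div_le_one (by positivity)]
      refine hQ3.trans ?_
      exact le_self_pow₀ hQ1 (by omega)
    have hsQ : Q * s = 2 * (1 / (Q : ℝ)^(m+1)) := by
      rw [hs]; field_simp; ring
    have herr : E * (L * Q) * s^2 ≤ 1 / (Q : ℝ)^(m+1) := by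
      have h1 : E * (L * Q) * s^2 = (4 * E * L) * (1 / (Q : ℝ)^(m+1)) * (1 / (Q : ℝ)^(m+2)) := by
        rw [hs]; field_simp; ring
      rw [h1]
      calc _ ≤ Q * (1 / (Q : ℝ)^(m+1)) * (1 / (Q : ℝ)^(m+2)) := by gcongr
        _ = (1 / (Q : ℝ)^(m+1)) * (1 / (Q : ℝ)^(m+1)) := by field_simp; ring
        _ ≤ _ := mul_le_of_le_one_right (by positivity) hone
    have t1 := (hE2 P _ hPn hcoef s (by rwa [abs_of_pos hs0])).trans herr
    have t2 := (hE2 P _ hPn hcoef (-s) (by rwa [abs_neg, abs_of_pos hs0])).trans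
      (le_of_eq_of_le (by rw [neg_sq]) herr)
    rw [abs_le] at t1 t2
    rw [abs_lt] at hPξ2
    have hcont : ContinuousOn (fun x : ℝ => aeval x P) (Set.Icc (ξ + -s) (ξ + s)) :=
      (Polynomial.continuous_aeval P).continuousOn
    have hle : ξ + -s ≤ ξ + s := by linarith
    obtain ⟨α, hα, hα0⟩ : ∃ α ∈ Set.Icc (ξ + -s) (ξ + s), aeval α P = 0 := by
      rcases le_abs.1 hder with hd | hd
      · have h1 : 2 * (1 / (Q : ℝ)^(m+1)) ≤ aeval ξ (derivative P) * s := by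
          rw [← hsQ]; gcongr
        have := intermediate_value_Icc hle hcont
        exact this ⟨by linarith [t2.2], by linarith [t1.1]⟩
      · have h1 : 2 * (1 / (Q : ℝ)^(m+1)) ≤ -aeval ξ (derivative P) * s := by
          rw [← hsQ]; gcongr
        have := intermediate_value_Icc' hle hcont
        exact this ⟨by linarith [t1.2], by linarith [t2.1]⟩
    have hAlg : IsAlgDegLe (m+1) α := ⟨P, hP, hα0, hPn⟩
    refine ⟨α, hAlg, ?_, ?_, ?_⟩
    · rw [abs_le]; constructor <;> linarith [hα.1, hα.2]
    · refine le_trans ?_ hPH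
      exact_mod_cast algHeight_le α P hP hα0
    · obtain ⟨P, hP, -, hPH⟩ := algHeight_spec α _ hAlg
      rw [← hPH]; exact one_le_polyHeight P hP
  have hnot : ¬ IsAlgDegLe (m+1) ξ := by
    rintro ⟨P, hP, h0, hPn⟩
    have h1 := hξ P hP hPn
    have h2 := one_le_polyHeight P hP
    rw [h0, abs_zero] at h1
    have : 0 < c / (polyHeight P : ℝ)^(m+1) := by positivity
    linarith
  refine ⟨3 * L^(m+2), by positivity, fun hfin => ?_⟩
  obtain ⟨δ, hδ, hδ2⟩ : ∃ δ : ℝ, 0 < δ ∧ ∀ α ∈ {α : ℝ | IsAlgDegLe (m+1) α ∧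
      |ξ - α| < 3 * L^(m+2) / (algHeight α : ℝ) ^ (m + 1 + 1)}, δ ≤ |ξ - α| := by
    have hmem : ({α : ℝ | IsAlgDegLe (m+1) α ∧
      |ξ - α| < 3 * L^(m+2) / (algHeight α : ℝ) ^ (m + 1 + 1)})ᶜ ∈ nhds ξ :=
      hfin.isClosed.isOpen_compl.mem_nhds (fun h => hnot h.1)
    obtain ⟨δ, hδ, hsub⟩ := Metric.mem_nhds_iff.1 hmem
    refine ⟨δ, hδ, fun α hα => ?_⟩
    by_contra hlt
    push Not at hlt
    have : α ∈ Metric.ball ξ δ := by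
      rw [Metric.mem_ball, dist_comm, Real.dist_eq]; exact hlt
    exact hsub this hα
  obtain ⟨Q, hQ⟩ := exists_nat_gt (max (4 * E * L) (max 2 (2 / δ)))
  rw [max_lt_iff, max_lt_iff] at hQ
  obtain ⟨hQ1, hQ2, hQ3⟩ := hQ
  have hQ0 : (0 : ℝ) < Q := by linarith
  obtain ⟨α, hα, hd, hH, hH1⟩ := key Q (by exact_mod_cast hQ0) hQ1.le hQ2.le
  have h1 : δ ≤ |ξ - α| := by
    refine hδ2 α ⟨hα, hd.trans_lt ?_⟩
    rw [div_lt_div_iff₀ (by positivity) (by positivity)]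
    have : (algHeight α : ℝ)^(m+1+1) ≤ L^(m+2) * (Q : ℝ)^(m+2) := by
      rw [← mul_pow]; gcongr
    have : 0 < L^(m+2) * (Q : ℝ)^(m+2) := by positivity
    linarith
  have h2 : 2 / (Q : ℝ)^(m+2) ≤ 2 / Q := by
    gcongr
    exact le_self_pow₀ (by linarith) (by omega)
  rw [div_lt_iff₀ hδ] at hQ3
  have h3 : 2 / (Q : ℝ) < δ := by rw [div_lt_iff₀ hQ0]; linarith
  linarith

theorem stmt6 (n : ℕ) (hn : 1 ≤ n) : BsetB n ⊆ WstarSet n ∩ BstarSet n := by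
  obtain ⟨m, rfl⟩ := Nat.exists_eq_add_of_le' hn
  exact Set.subset_inter (Wstar_part m) (Bstar_part (m+1))
end

section
/- Let ℓ ∈ ℕ with ℓ ≤ n+1 and let θ = (θ₀,…,θₙ) with θ₀,…,θₙ > 0. Then for any linear subspace V of ℝ^{n+1} of dimension ℓ, vol_ℓ(Π_θ ∩ V) ≤ 2^ℓ (n+1)^{ℓ/2} Θ_ℓ, where Θ_ℓ = max over subsets I ⊆ {0,…,n} of cardinality ℓ of ∏_{i ∈ I} θᵢ. -/
open MeasureTheory ENNReal

/-- A symmetrised Cauchy-Binet formula. -/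
lemma cauchyBinet_aux {m k : Type*} [Fintype m] [DecidableEq m] [Fintype k] [DecidableEq k]
    (Q : Matrix m k ℝ) (d : m → ℝ) :
    ((Fintype.card k).factorial : ℝ) * (Matrix.of fun i j => ∑ a, d a * Q a i * Q a j).det =
      ∑ f : k → m, (∏ i, d (f i)) * (Q.submatrix f id).det ^ 2 := by
  have h1 : (Matrix.of fun i j => ∑ a, d a * Q a i * Q a j).det =
      ∑ f : k → m, (∏ i, d (f i)) * (∏ i, Q (f i) i) * (Q.submatrix f id).det := by
    rw [Matrix.det_apply']
    simp only [Matrix.of_apply, Finset.prod_univ_sum, Fintype.piFinset_univ, Finset.mul_sum]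
    rw [Finset.sum_comm]
    refine Finset.sum_congr rfl fun f _ => ?_
    rw [← Matrix.det_transpose, Matrix.det_apply', Finset.mul_sum]
    refine Finset.sum_congr rfl fun σ _ => ?_
    simp only [Matrix.transpose_apply, Matrix.submatrix_apply, id, Finset.prod_mul_distrib]
    ring
  have h2 : ∀ τ : Equiv.Perm k, (Matrix.of fun i j => ∑ a, d a * Q a i * Q a j).det =
      ∑ f : k → m, (∏ i, d (f i)) * (Q.submatrix f id).det *
        (((Equiv.Perm.sign τ : ℤ) : ℝ) * ∏ i, (Q.submatrix f id) (τ i) i) := by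
    intro τ
    rw [h1, ← (Equiv.arrowCongr τ.symm (Equiv.refl m)).sum_comp]
    refine Finset.sum_congr rfl fun f _ => ?_
    have e1 : ∏ i, d ((Equiv.arrowCongr τ.symm (Equiv.refl m)) f i) = ∏ i, d (f i) := by
      exact Equiv.prod_comp τ (fun i => d (f i))
    have e2 : (Q.submatrix ((Equiv.arrowCongr τ.symm (Equiv.refl m)) f) id).det =
        ((Equiv.Perm.sign τ : ℤ) : ℝ) * (Q.submatrix f id).det := by
      rw [← Matrix.det_permute]
      rfl
    rw [e1, e2]
    have e3 : ∏ i, Q ((Equiv.arrowCongr τ.symm (Equiv.refl m)) f i) i =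
        ∏ i, (Q.submatrix f id) (τ i) i := rfl
    rw [e3]
    ring
  have h3 : ∑ _τ : Equiv.Perm k, (Matrix.of fun i j => ∑ a, d a * Q a i * Q a j).det =
      ((Fintype.card k).factorial : ℝ) * (Matrix.of fun i j => ∑ a, d a * Q a i * Q a j).det := by
    rw [Finset.sum_const, Finset.card_univ, Fintype.card_perm, nsmul_eq_mul]
  rw [← h3, Finset.sum_congr rfl fun τ _ => h2 τ, Finset.sum_comm]
  refine Finset.sum_congr rfl fun f _ => ?_
  rw [← Finset.mul_sum, ← Matrix.det_apply']
  ring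

lemma gram_det_le {m k : Type*} [Fintype m] [DecidableEq m] [Fintype k] [DecidableEq k]
    (Q : Matrix m k ℝ) (θ : m → ℝ) (hθ : ∀ i, 0 < θ i) (C : ℝ)
    (hC : ∀ I : Finset m, I.card = Fintype.card k → ∏ i ∈ I, θ i ≤ C)
    (hQ : ∀ i j, ∑ a, Q a i * Q a j = (1 : Matrix k k ℝ) i j) :
    (Matrix.of fun i j => ∑ a, θ a ^ 2 * Q a i * Q a j).det ≤ C ^ 2 := by
  have hpos : (0 : ℝ) < ((Fintype.card k).factorial : ℝ) := by positivity
  refine le_of_mul_le_mul_left ?_ hpos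
  have h1 := cauchyBinet_aux Q (fun _ => 1)
  have h0 : (Matrix.of fun i j => ∑ a, (1 : ℝ) * Q a i * Q a j) = (1 : Matrix k k ℝ) := by
    ext i j
    simp only [Matrix.of_apply, one_mul]
    exact hQ i j
  rw [h0, Matrix.det_one] at h1
  rw [cauchyBinet_aux Q (fun a => θ a ^ 2), ← mul_one (Nat.cast _ : ℝ), h1, Finset.sum_mul]
  refine Finset.sum_le_sum fun f _ => ?_
  by_cases hf : Function.Injective f
  · have h2 : ∏ i, θ (f i) ≤ C := by
      have := hC (Finset.univ.image f) (by
        rw [Finset.card_image_of_injective _ hf, Finset.card_univ])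
      rwa [Finset.prod_image (fun x _ y _ h => hf h)] at this
    have h3 : 0 ≤ ∏ i, θ (f i) := Finset.prod_nonneg fun i _ => (hθ _).le
    rw [Finset.prod_pow, Finset.prod_const_one, one_mul, mul_comm]
    gcongr
  · have : (Q.submatrix f id).det = 0 := by
      simp only [Function.Injective, not_forall] at hf
      obtain ⟨i, j, hij, hne⟩ := hf
      refine Matrix.det_zero_of_row_eq hne ?_
      ext x
      simp [hij]
    simp [this]

/-- With the normalisation in use, a ball has Hausdorff measure at most its diameter
to the power of the dimension. -/
lemma hausdorff_closedBall_le (ℓ : ℕ) (hℓ : 1 ≤ ℓ) (R : ℝ) (hR : 0 ≤ R) :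
    μH[(ℓ : ℝ)] (Metric.closedBall (0 : EuclideanSpace ℝ (Fin ℓ)) R) ≤
      ENNReal.ofReal ((2 * R) ^ ℓ) := by
  set μ : Measure (EuclideanSpace ℝ (Fin ℓ)) := μH[(ℓ : ℝ)] with hμ
  have hfr : Module.finrank ℝ (EuclideanSpace ℝ (Fin ℓ)) = ℓ := by simp
  set c := μ (Metric.closedBall (0 : EuclideanSpace ℝ (Fin ℓ)) 1) with hc
  have hball : ∀ x : EuclideanSpace ℝ (Fin ℓ), ∀ r, 0 ≤ r →
      μ (Metric.closedBall x r) = ENNReal.ofReal (r ^ ℓ) * c := by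
    intro x r hr
    have := Measure.addHaar_closedBall' μ x hr
    rwa [hfr] at this
  have hc0 : c ≠ 0 := (Metric.measure_closedBall_pos μ _ one_pos).ne'
  have hct : c ≠ ∞ := measure_closedBall_lt_top.ne
  set S := Metric.closedBall (0 : EuclideanSpace ℝ (Fin ℓ)) R
  have key : ∀ n : ℕ, ∃ (t : Set (EuclideanSpace ℝ (Fin ℓ))) (r : EuclideanSpace ℝ (Fin ℓ) → ℝ),
      t.Countable ∧ t ⊆ S ∧ (∀ x ∈ t, r x ∈ Set.Ioo (0 : ℝ) (1 / (n + 1))) ∧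
      (S ⊆ ⋃ x ∈ t, Metric.closedBall x (r x)) ∧
      (∑' x : t, μ (Metric.closedBall (x : EuclideanSpace ℝ (Fin ℓ)) (r x))) ≤
        μ S + ((n : ℝ≥0∞) + 1)⁻¹ := by
    intro n
    refine Besicovitch.exists_closedBall_covering_tsum_measure_le μ
      (ε := ((n : ℝ≥0∞) + 1)⁻¹) (by simp) (fun _ => Set.Ioo (0 : ℝ) (1 / (n + 1))) S ?_
    intro x _ δ hδ
    have h1 : (0 : ℝ) < 1 / (n + 1) := by positivity
    refine ⟨min δ (1 / (n + 1)) / 2, ⟨?_, ?_⟩, ?_, ?_⟩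
    · positivity
    · have := min_le_right δ (1 / ((n : ℝ) + 1)); linarith
    · positivity
    · have := min_le_left δ (1 / ((n : ℝ) + 1)); linarith
  choose t r htc hts hr hcov hsum using key
  have : ∀ n, Countable (t n) := fun n => (htc n).to_subtype
  have hdiam : ∀ n (x : t n), Metric.ediam (Metric.closedBall (x : EuclideanSpace ℝ (Fin ℓ)) (r n x))
      ≤ ENNReal.ofReal (2 * r n x) := by
    intro n x
    rw [ENNReal.ofReal_mul (by norm_num), ENNReal.ofReal_ofNat, ← Metric.closedEBall_ofReal (hr n x x.2).1.le]
    exact Metric.ediam_closedEBall_le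
  have h1 := Measure.hausdorffMeasure_le_liminf_tsum (ι := fun n => t n) (ℓ : ℝ) S
    (l := Filter.atTop)
    (fun n : ℕ => ENNReal.ofReal (2 * (1 / ((n : ℝ) + 1)))) (by
      rw [← ENNReal.ofReal_zero]
      refine (ENNReal.continuous_ofReal.tendsto _).comp ?_
      simpa using (tendsto_one_div_add_atTop_nhds_zero_nat (𝕜 := ℝ)).const_mul 2)
    (fun n x => Metric.closedBall (x : EuclideanSpace ℝ (Fin ℓ)) (r n x))
    (Filter.Eventually.of_forall fun n x => (hdiam n x).trans
      (ENNReal.ofReal_le_ofReal (by have := (hr n x x.2).2; linarith)))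
    (Filter.Eventually.of_forall fun n => by
      have := hcov n
      rwa [Set.biUnion_eq_iUnion] at this)
  have h2 : ∀ n, ∑' x : t n, Metric.ediam
      (Metric.closedBall (x : EuclideanSpace ℝ (Fin ℓ)) (r n x)) ^ (ℓ : ℝ) ≤
      (2 ^ ℓ / c) * (μ S + ((n : ℝ≥0∞) + 1)⁻¹) := by
    intro n
    refine le_trans ?_ (mul_le_mul_right (hsum n) _)
    rw [← ENNReal.tsum_mul_left]
    refine ENNReal.tsum_le_tsum fun x => ?_
    have hx := (hr n x x.2).1.le
    rw [hball _ _ hx, ENNReal.rpow_natCast]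
    calc _ ≤ ENNReal.ofReal (2 * r n x) ^ ℓ := pow_le_pow_left₀ zero_le (hdiam n x) ℓ
      _ = 2 ^ ℓ * ENNReal.ofReal (r n x ^ ℓ) := by
        rw [ENNReal.ofReal_mul (by norm_num), mul_pow, ENNReal.ofReal_pow hx, ENNReal.ofReal_ofNat]
      _ = _ := by
        rw [mul_comm (ENNReal.ofReal _) c, ← mul_assoc, ENNReal.div_mul_cancel hc0 hct]
  have h3 : Filter.Tendsto (fun n : ℕ => (2 ^ ℓ / c) * (μ S + ((n : ℝ≥0∞) + 1)⁻¹)) Filter.atTop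
      (nhds ((2 ^ ℓ / c) * (μ S + 0))) := by
    refine ENNReal.Tendsto.const_mul ?_ (Or.inr (ENNReal.div_ne_top (by simp) hc0))
    refine tendsto_const_nhds.add ?_
    have := (Filter.tendsto_add_atTop_iff_nat 1).2 ENNReal.tendsto_inv_nat_nhds_zero
    simpa using this
  have h4 : μ S ≤ (2 ^ ℓ / c) * (μ S + 0) := by
    rw [← h3.liminf_eq]
    exact h1.trans (Filter.liminf_le_liminf (Filter.Eventually.of_forall h2))
  refine h4.trans (le_of_eq ?_)
  rw [add_zero, hball _ _ hR, mul_comm (ENNReal.ofReal _) c, ← mul_assoc,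
    ENNReal.div_mul_cancel hc0 hct, mul_pow, ENNReal.ofReal_mul (by positivity),
    ENNReal.ofReal_pow (zero_le_two (α := ℝ)), ENNReal.ofReal_ofNat]

/-- Diagonal scaling of Euclidean space. -/
noncomputable def diagScale {m : Type*} (θ : m → ℝ) (hθ : ∀ i, 0 < θ i) :
    EuclideanSpace ℝ m ≃ₗ[ℝ] EuclideanSpace ℝ m where
  toFun := fun x => WithLp.toLp 2 fun i => θ i * x i
  invFun := fun x => WithLp.toLp 2 fun i => (θ i)⁻¹ * x i
  map_add' := fun x y => by ext i; simp [mul_add]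
  map_smul' := fun r x => by ext i; simp [mul_left_comm]
  left_inv := fun x => by ext i; simp [(hθ i).ne']
  right_inv := fun x => by ext i; simp [(hθ i).ne']

lemma slice_aux (n ℓ : ℕ) (hℓ : 1 ≤ ℓ)
    (θ : Fin (n + 1) → ℝ) (hθ : ∀ i, 0 < θ i) (C : ℝ) (hC0 : 0 ≤ C)
    (hC : ∀ I : Finset (Fin (n + 1)), I.card = ℓ → ∏ i ∈ I, θ i ≤ C)
    (V V' : Submodule ℝ (EuclideanSpace ℝ (Fin (n + 1))))
    (T : EuclideanSpace ℝ (Fin (n + 1)) →ₗ[ℝ] EuclideanSpace ℝ (Fin (n + 1))) (hT : ∀ x i, T x i = θ i * x i)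
    (e : V' ≃ₗ[ℝ] V) (he : ∀ x : V', ((e x : V) : EuclideanSpace ℝ (Fin (n + 1))) = T x)
    (w : V ≃ₗᵢ[ℝ] EuclideanSpace ℝ (Fin ℓ)) (u : V' ≃ₗᵢ[ℝ] EuclideanSpace ℝ (Fin ℓ)) :
    μH[(ℓ : ℝ)] ({x : EuclideanSpace ℝ (Fin (n + 1)) | ∀ i, |x i| < θ i} ∩ (V : Set (EuclideanSpace ℝ (Fin (n + 1))))) ≤
      ENNReal.ofReal ((2 : ℝ) ^ ℓ * ((n : ℝ) + 1) ^ ((ℓ : ℝ) / 2) * C) := by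
  classical
  obtain ⟨φ, hφ⟩ : ∃ φ : EuclideanSpace ℝ (Fin ℓ) →ₗ[ℝ] EuclideanSpace ℝ (Fin ℓ), ∀ x, φ x = w (e (u.symm x)) :=
    ⟨w.toLinearEquiv.toLinearMap ∘ₗ e.toLinearMap ∘ₗ u.symm.toLinearEquiv.toLinearMap,
      fun x => rfl⟩
  let b := EuclideanSpace.basisFun (Fin ℓ) ℝ
  let Q : Matrix (Fin (n + 1)) (Fin ℓ) ℝ := Matrix.of fun a i => ((u.symm (b i) : V') : EuclideanSpace ℝ (Fin (n + 1))) a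
  have hQ : ∀ i j, ∑ a, Q a i * Q a j = (1 : Matrix (Fin ℓ) (Fin ℓ) ℝ) i j := by
    intro i j
    have h1 : inner ℝ ((u.symm (b i) : V') : EuclideanSpace ℝ (Fin (n + 1))) ((u.symm (b j) : V') : EuclideanSpace ℝ (Fin (n + 1))) = inner ℝ (b i) (b j) := by
      rw [← Submodule.coe_inner, u.symm.inner_map_map]
    rw [b.inner_eq_ite, PiLp.inner_apply] at h1
    rw [Matrix.one_apply, ← h1]
    refine Finset.sum_congr rfl fun a _ => ?_
    simp [Q, mul_comm]
  have hdet : LinearMap.det φ ^ 2 ≤ C ^ 2 := by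
    have h1 := gram_det_le Q θ hθ C (by simpa using hC) hQ
    refine le_trans (le_of_eq ?_) h1
    rw [← LinearMap.det_toMatrix b.toBasis, sq]
    nth_rewrite 1 [← Matrix.det_transpose]
    rw [← Matrix.det_mul]
    congr 1
    ext i j
    have h2 : inner ℝ (φ (b i)) (φ (b j)) =
        inner ℝ (T (u.symm (b i) : V')) (T (u.symm (b j) : V')) := by
      rw [hφ, hφ, w.inner_map_map, Submodule.coe_inner, he, he]
    rw [PiLp.inner_apply, PiLp.inner_apply] at h2
    rw [Matrix.mul_apply, Matrix.of_apply]
    calc _ = ∑ a, inner ℝ (φ (b i) a) (φ (b j) a) := by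
          refine Finset.sum_congr rfl fun a _ => ?_
          simp [LinearMap.toMatrix_apply, b, mul_comm]
      _ = _ := by
          rw [h2]
          refine Finset.sum_congr rfl fun a _ => ?_
          simp only [hT, Q, Matrix.of_apply]
          simp
          ring
  have hdet' : |LinearMap.det φ| ≤ C := abs_le_of_sq_le_sq hdet hC0
  set R : ℝ := Real.sqrt ((n : ℝ) + 1) with hRdef
  have hsub : {x : EuclideanSpace ℝ (Fin (n + 1)) | ∀ i, |x i| < θ i} ∩ (V : Set (EuclideanSpace ℝ (Fin (n + 1)))) ⊆
      (fun x : EuclideanSpace ℝ (Fin ℓ) => ((w.symm x : V) : EuclideanSpace ℝ (Fin (n + 1)))) '' (φ '' Metric.closedBall (0 : EuclideanSpace ℝ (Fin ℓ)) R) := by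
    rintro x ⟨hx, hxV⟩
    have hx : ∀ i, |x i| < θ i := hx
    refine ⟨w ⟨x, hxV⟩, ⟨u (e.symm ⟨x, hxV⟩), ?_, by simp [hφ]⟩, by simp⟩
    rw [mem_closedBall_zero_iff, u.norm_map, Submodule.coe_norm]
    set y : EuclideanSpace ℝ (Fin (n + 1)) := ((e.symm ⟨x, hxV⟩ : V') : EuclideanSpace ℝ (Fin (n + 1))) with hy
    have hTy : T y = x := by rw [hy, ← he, e.apply_symm_apply]
    rw [EuclideanSpace.norm_eq]
    refine Real.sqrt_le_sqrt ?_
    calc ∑ i, ‖y i‖ ^ 2 ≤ ∑ _i : Fin (n + 1), (1 : ℝ) := by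
          refine Finset.sum_le_sum fun i _ => ?_
          have h1 := hx i
          rw [← hTy, hT, abs_mul, abs_of_pos (hθ i)] at h1
          have h2 : |y i| < 1 := by
            by_contra h
            push Not at h
            nlinarith [hθ i]
          rw [Real.norm_eq_abs]
          exact pow_le_one₀ (abs_nonneg _) h2.le
      _ = (n : ℝ) + 1 := by simp
  refine (measure_mono hsub).trans ?_
  have hiso : Isometry (fun x : EuclideanSpace ℝ (Fin ℓ) => ((w.symm x : V) : EuclideanSpace ℝ (Fin (n + 1)))) :=
    isometry_subtype_coe.comp w.symm.isometry
  rw [hiso.hausdorffMeasure_image (Or.inl (by positivity)), Measure.addHaar_image_linearMap]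
  refine (mul_le_mul' (ENNReal.ofReal_le_ofReal hdet')
    (hausdorff_closedBall_le ℓ hℓ R (Real.sqrt_nonneg _))).trans ?_
  rw [← ENNReal.ofReal_mul hC0]
  refine le_of_eq (congrArg _ ?_)
  have hRp : R ^ ℓ = ((n : ℝ) + 1) ^ ((ℓ : ℝ) / 2) := by
    rw [hRdef, Real.sqrt_eq_rpow, ← Real.rpow_natCast, ← Real.rpow_mul (by positivity)]
    congr 1
    ring
  rw [mul_pow, hRp]
  ring

theorem stmt9 (n ℓ : ℕ) (hℓ : 1 ≤ ℓ) (hℓn : ℓ ≤ n + 1)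
    (θ : Fin (n + 1) → ℝ) (hθ : ∀ i, 0 < θ i)
    (V : Submodule ℝ (EuclideanSpace ℝ (Fin (n + 1))))
    (hV : Module.finrank ℝ V = ℓ) :
    μH[(ℓ : ℝ)] ({x : EuclideanSpace ℝ (Fin (n + 1)) | ∀ i, |x i| < θ i} ∩
        (V : Set (EuclideanSpace ℝ (Fin (n + 1))))) ≤
      ENNReal.ofReal ((2 : ℝ) ^ ℓ * ((n : ℝ) + 1) ^ ((ℓ : ℝ) / 2) *
        sSup {p : ℝ | ∃ I : Finset (Fin (n + 1)), I.card = ℓ ∧ p = ∏ i ∈ I, θ i}) := by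
  classical
  set C := sSup {p : ℝ | ∃ I : Finset (Fin (n + 1)), I.card = ℓ ∧ p = ∏ i ∈ I, θ i} with hCdef
  have hfin : {p : ℝ | ∃ I : Finset (Fin (n + 1)), I.card = ℓ ∧ p = ∏ i ∈ I, θ i}.Finite := by
    refine (Set.finite_range fun I : Finset (Fin (n + 1)) => ∏ i ∈ I, θ i).subset ?_
    rintro p ⟨I, _, rfl⟩
    exact ⟨I, rfl⟩
  have hC : ∀ I : Finset (Fin (n + 1)), I.card = ℓ → ∏ i ∈ I, θ i ≤ C := fun I hI =>
    le_csSup hfin.bddAbove ⟨I, hI, rfl⟩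
  have hC0 : 0 ≤ C := by
    refine Real.sSup_nonneg ?_
    rintro p ⟨I, _, rfl⟩
    exact Finset.prod_nonneg fun i _ => (hθ i).le
  have hV' : Module.finrank ℝ
      (V.comap (diagScale θ hθ : EuclideanSpace ℝ (Fin (n + 1)) →ₗ[ℝ] _)) = ℓ := by
    rw [((diagScale θ hθ).ofSubmodule' V).finrank_eq, hV]
  exact slice_aux n ℓ hℓ θ hθ C hC0 hC V _ (diagScale θ hθ).toLinearMap (fun x i => rfl)
    ((diagScale θ hθ).ofSubmodule' V) (fun x => rfl)
    ((stdOrthonormalBasis ℝ V).reindex (finCongr hV)).repr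
    ((stdOrthonormalBasis ℝ _).reindex (finCongr hV')).repr
end

section
/- Let 𝓕 be a finite family of Cⁿ maps f = (f₁,…,fₙ) : I → ℝⁿ and let I₀ ⊆ I be a compact interval satisfying Property F with constants 0 < c₀ < 1 < c₁. Set 2c₂ = c₀ c₁^{−n+1} (n!)⁻¹. Then for any f ∈ 𝓕, any a = (a₁,…,aₙ) ∈ ℤⁿ \ {0} and any x ∈ I₀, there exists i ∈ {1,…,n} such that |a·f^{(i)}(x)| ≥ 2c₂ max_{1≤j≤n} |a_j|, where a·f^{(i)}(x) = a₁ f₁^{(i)}(x) + ⋯ + aₙ fₙ^{(i)}(x). -/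
/-- Property F for a family of maps `f = (f₁,…,fₙ) : ℝ → ℝⁿ` on `I₀`, with
constants `0 < c₀ < 1 < c₁`: the Wronskian-type determinant `det(f_j^{(i)})`
and the first derivatives are bounded below, and all derivatives of orders
`1,…,n` are bounded above. -/
def PropertyF {n : ℕ} (F : Set (ℝ → Fin n → ℝ)) (I₀ : Set ℝ) (c₀ c₁ : ℝ) : Prop :=
  0 < c₀ ∧ c₀ < 1 ∧ 1 < c₁ ∧
  ∀ f ∈ F, ∀ x ∈ I₀,
    c₀ < |Matrix.det (Matrix.of fun i j : Fin n =>
      iteratedDeriv (i.1 + 1) (fun y => f y j) x)| ∧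
    ∀ j : Fin n, c₀ < |deriv (fun y => f y j) x| ∧
      ∀ i : Fin n, |iteratedDeriv (i.1 + 1) (fun y => f y j) x| < c₁

/-- The maximum of the absolute values of the components of an integer vector. -/
def intMaxAbs {n : ℕ} (a : Fin n → ℤ) : ℕ := Finset.univ.sup fun j => (a j).natAbs

theorem det_bound_aux {n : ℕ} (M : Matrix (Fin n) (Fin n) ℝ) (v : Fin n → ℝ) (j : Fin n)
    (c B : ℝ) (hM : ∀ i k, |M i k| ≤ c) (hv : ∀ i, |v i| ≤ B) :
    |(M.updateCol j v).det| ≤ (n.factorial : ℝ) * (c ^ (n - 1) * B) := by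
  rw [Matrix.det_apply]
  refine (Finset.abs_sum_le_sum_abs _ _).trans ?_
  have key : ∀ σ ∈ (Finset.univ : Finset (Equiv.Perm (Fin n))),
      |Equiv.Perm.sign σ • ∏ k, M.updateCol j v (σ k) k| ≤ c ^ (n - 1) * B := by
    intro σ _
    have h1 : |Equiv.Perm.sign σ • ∏ k, M.updateCol j v (σ k) k|
        = ∏ k, |M.updateCol j v (σ k) k| := by
      rw [← Finset.abs_prod]
      rcases Int.units_eq_one_or (Equiv.Perm.sign σ) with h | h <;> simp [h]
    rw [h1]
    calc ∏ k, |M.updateCol j v (σ k) k| ≤ ∏ k, (if k = j then B else c) := by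
          refine Finset.prod_le_prod (fun _ _ => abs_nonneg _) (fun k _ => ?_)
          by_cases hk : k = j
          · subst hk; simpa using hv _
          · simpa [Matrix.updateCol_apply, hk] using hM _ _
      _ = c ^ (n - 1) * B := by
          rw [← Finset.prod_erase_mul _ _ (Finset.mem_univ j)]
          have : ∏ k ∈ Finset.univ.erase j, (if k = j then B else c) = c ^ (n - 1) := by
            rw [Finset.prod_congr rfl (g := fun _ => c)
              (fun k hk => if_neg (Finset.ne_of_mem_erase hk))]
            simp
          rw [this]; simp
  refine (Finset.sum_le_sum key).trans ?_
  simp [Fintype.card_perm]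

theorem stmt12 (n : ℕ) (hn : 1 ≤ n) (I : Set ℝ)
    (F : Set (ℝ → Fin n → ℝ)) (hFfin : F.Finite)
    (hsmooth : ∀ f ∈ F, ∀ j : Fin n, ContDiffOn ℝ n (fun x => f x j) I)
    (a₀ b₀ : ℝ) (hab : a₀ < b₀) (I₀ : Set ℝ) (hI₀ : I₀ = Set.Icc a₀ b₀)
    (hsub : I₀ ⊆ I) (c₀ c₁ : ℝ) (hPF : PropertyF F I₀ c₀ c₁)
    (c₂ : ℝ) (hc₂ : 2 * c₂ = c₀ * (c₁ ^ (n - 1))⁻¹ * ((Nat.factorial n : ℝ))⁻¹) :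
    ∀ f ∈ F, ∀ a : Fin n → ℤ, a ≠ 0 → ∀ x ∈ I₀, ∃ i : Fin n,
      2 * c₂ * (intMaxAbs a : ℝ) ≤
        |∑ j, (a j : ℝ) * iteratedDeriv (i.1 + 1) (fun y => f y j) x| := by
  intro f hf a ha x hx
  obtain ⟨h0, -, h1, hP⟩ := hPF
  obtain ⟨hdet, hb⟩ := hP f hf x hx
  set M : Matrix (Fin n) (Fin n) ℝ := Matrix.of fun i j : Fin n =>
      iteratedDeriv (i.1 + 1) (fun y => f y j) x with hMdef
  by_contra! hcon
  haveI : Nonempty (Fin n) := ⟨⟨0, hn⟩⟩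
  obtain ⟨j, -, hj⟩ := Finset.exists_mem_eq_sup (Finset.univ : Finset (Fin n))
    Finset.univ_nonempty (fun j => (a j).natAbs)
  have hA : (intMaxAbs a : ℝ) = |(a j : ℝ)| := by
    unfold intMaxAbs
    rw [hj, Nat.cast_natAbs, Int.cast_abs]
  have hApos : 0 < (intMaxAbs a : ℝ) := by
    obtain ⟨k, hk⟩ := Function.ne_iff.mp ha
    have h2 : (a k).natAbs ≤ intMaxAbs a :=
      Finset.le_sup (f := fun j => (a j).natAbs) (Finset.mem_univ k)
    have h3 : 0 < (a k).natAbs := Int.natAbs_pos.mpr hk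
    exact_mod_cast h3.trans_le h2
  set w : Fin n → ℝ := fun j => (a j : ℝ) with hw
  have hcr : (M.updateCol j (M.mulVec w)).det = M.det * w j := by
    rw [← Matrix.cramer_apply, Matrix.cramer_eq_adjugate_mulVec, Matrix.mulVec_mulVec,
      Matrix.adjugate_mul, Matrix.smul_mulVec, Matrix.one_mulVec]
    simp
  have hv : ∀ i, |M.mulVec w i| ≤ 2 * c₂ * (intMaxAbs a : ℝ) := by
    intro i
    refine le_trans (le_of_eq ?_) (hcon i).le
    congr 1
    simp only [Matrix.mulVec, dotProduct, hMdef, Matrix.of_apply, hw]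
    exact Finset.sum_congr rfl fun _ _ => mul_comm _ _
  have hbd := det_bound_aux M (M.mulVec w) j c₁ _ (fun i k => ((hb k).2 i).le) hv
  rw [hcr, abs_mul, ← hA, hc₂] at hbd
  have hc : c₁ ^ (n - 1) ≠ 0 := pow_ne_zero _ (by linarith)
  have hfa : (n.factorial : ℝ) ≠ 0 := by exact_mod_cast n.factorial_ne_zero
  have he : (n.factorial : ℝ) * (c₁ ^ (n - 1) * (c₀ * (c₁ ^ (n - 1))⁻¹ * (n.factorial : ℝ)⁻¹
      * (intMaxAbs a : ℝ))) = c₀ * (intMaxAbs a : ℝ) := by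
    field_simp
  rw [he] at hbd
  exact absurd hbd (not_le.mpr (mul_lt_mul_of_pos_right hdet hApos))
end

section
/- Let 𝓕 be a finite family of Cⁿ maps I → ℝⁿ, let I₀ ⊆ I be a compact interval satisfying Property F with constants c₀, c₁, let c₂ and δ₀ be as produced by the previous two lemmas, let f ∈ 𝓕, r ∈ R_n and γ = γ(r) = max{r₁,…,rₙ}. Let t ∈ ℕ, ℓ ∈ ℤ_{≥0}, b > 1, a ∈ ℤⁿ \ {0}, a₀ ∈ ℤ and 0 < κ < 1, and define D¹ = {x ∈ I₀ : |a₀ + a·f(x)| < κ b^{−t}, b^{γt−(1+γ)ℓ} ≤ |a·f′(x)| < b^{γt−(1+γ)(ℓ−1)}, and |aᵢ| < b^{rᵢ t} for 1 ≤ i ≤ n}. Then there is a constant c₃ > 0 depending only on n, |I₀|, c₁, c₂ and δ₀ such that D¹ can be covered by a collection of at most c₃ intervals Δ each of length |Δ| ≤ κ b^{−(1+γ)(t−ℓ)}. -/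
/-- The set `R_n` of weight vectors: nonnegative components summing to `1`. -/
def Weights (n : ℕ) : Set (Fin n → ℝ) := {r | (∑ i, r i) = 1 ∧ ∀ i, 0 ≤ r i}

/-- `γ(r) = max {r₁, …, rₙ}`. -/
noncomputable def gammaW {n : ℕ} (r : Fin n → ℝ) : ℝ := sSup (Set.range r)

/-- `S` can be covered by at most `N` closed intervals of length at most `L`. -/
def Cov14 (S : Set ℝ) (N : ℕ) (L : ℝ) : Prop :=
  ∃ D : Finset (Set ℝ), D.card ≤ N ∧
    (∀ Δ ∈ D, ∃ u v : ℝ, Δ = Set.Icc u v ∧ v - u ≤ L) ∧ S ⊆ ⋃ Δ ∈ D, Δ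

theorem Cov14.mono {S T : Set ℝ} {N M : ℕ} {L : ℝ} (h : Cov14 T N L) (hST : S ⊆ T)
    (hNM : N ≤ M) : Cov14 S M L := by
  obtain ⟨D, h1, h2, h3⟩ := h
  exact ⟨D, h1.trans hNM, h2, hST.trans h3⟩

theorem Cov14.biUnion {ι : Type*} (s : Finset ι) (S : ι → Set ℝ) {N : ℕ} {L : ℝ}
    (h : ∀ i ∈ s, Cov14 (S i) N L) : Cov14 (⋃ i ∈ s, S i) (s.card * N) L := by
  classical
  choose! D h1 h2 h3 using h
  refine ⟨s.biUnion D, Finset.card_biUnion_le_card_mul _ _ _ h1, ?_, ?_⟩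
  · intro Δ hΔ
    obtain ⟨i, hi, hΔ⟩ := Finset.mem_biUnion.1 hΔ
    exact h2 i hi Δ hΔ
  · intro x hx
    simp only [Set.mem_iUnion] at hx
    obtain ⟨i, hi, hx⟩ := hx
    have := h3 i hi hx
    simp only [Set.mem_iUnion] at this ⊢
    obtain ⟨Δ, hΔ, hx⟩ := this
    exact ⟨Δ, Finset.mem_biUnion.2 ⟨i, hi, hΔ⟩, hx⟩

theorem Cov14.union {S T : Set ℝ} {N M : ℕ} {L : ℝ} (hS : Cov14 S N L) (hT : Cov14 T M L) :
    Cov14 (S ∪ T) (N + M) L := by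
  classical
  obtain ⟨D, h1, h2, h3⟩ := hS
  obtain ⟨E, k1, k2, k3⟩ := hT
  refine ⟨D ∪ E, (Finset.card_union_le _ _).trans (by omega), ?_, ?_⟩
  · intro Δ hΔ
    rcases Finset.mem_union.1 hΔ with h | h
    · exact h2 Δ h
    · exact k2 Δ h
  · rintro x (hx | hx)
    · have := h3 hx
      simp only [Set.mem_iUnion] at this ⊢
      obtain ⟨Δ, hΔ, hx⟩ := this
      exact ⟨Δ, Finset.mem_union_left _ hΔ, hx⟩
    · have := k3 hx
      simp only [Set.mem_iUnion] at this ⊢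
      obtain ⟨Δ, hΔ, hx⟩ := this
      exact ⟨Δ, Finset.mem_union_right _ hΔ, hx⟩

theorem Cov14.Icc (u v : ℝ) {L : ℝ} (h : v - u ≤ L) : Cov14 (Set.Icc u v) 1 L :=
  ⟨{Set.Icc u v}, by simp, by
    intro Δ hΔ
    exact ⟨u, v, Finset.mem_singleton.1 hΔ, h⟩, by simp⟩

theorem Cov14.of_dist {S : Set ℝ} {P : ℕ} {L : ℝ} (hL : 0 < L)
    (h : ∀ x ∈ S, ∀ y ∈ S, x ≤ y → y - x ≤ P * L) : Cov14 S (P + 1) L := by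
  rcases S.eq_empty_or_nonempty with rfl | ⟨x₀, hx₀⟩
  · exact ⟨∅, by simp, by simp, by simp⟩
  have hbdd : BddBelow S := by
    refine ⟨x₀ - P * L, fun x hx => ?_⟩
    rcases le_total x x₀ with h' | h'
    · linarith [h x hx x₀ hx₀ h']
    · have : 0 ≤ P * L := by positivity
      linarith
  set u := sInf S with hu
  have hu1 : ∀ x ∈ S, u ≤ x := fun x hx => csInf_le hbdd hx
  have hu2 : ∀ x ∈ S, x - u ≤ P * L := by
    intro x hx
    have : x - P * L ≤ u := by
      refine le_csInf ⟨x₀, hx₀⟩ fun y hy => ?_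
      rcases le_total y x with h' | h'
      · linarith [h y hy x hx h']
      · have : 0 ≤ P * L := by positivity
        linarith
    linarith
  have key := Cov14.biUnion (Finset.range (P + 1))
    (fun k : ℕ => Set.Icc (u + k * L) (u + (k + 1) * L)) (N := 1) (L := L)
    (fun k _ => Cov14.Icc _ _ (by linarith))
  refine key.mono ?_ (by simp)
  intro x hx
  have h0 : 0 ≤ (x - u) / L := div_nonneg (by linarith [hu1 x hx]) hL.le
  have e : (x - u) / L * L = x - u := by field_simp
  simp only [Set.mem_iUnion, Finset.mem_range]
  refine ⟨⌊(x - u) / L⌋₊, ?_, ?_, ?_⟩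
  · rw [Nat.lt_succ_iff]
    have : (x - u) / L ≤ P := by rw [div_le_iff₀ hL]; exact hu2 x hx
    exact_mod_cast (Nat.floor_le h0).trans this
  · nlinarith [Nat.floor_le h0]
  · nlinarith [Nat.lt_floor_add_one ((x - u) / L)]

theorem Cov14.of_deriv {g g' : ℝ → ℝ} {K : Set ℝ} (hK : K.OrdConnected)
    (hg : ∀ x ∈ K, HasDerivAt g (g' x) x) {C ε L : ℝ} {P : ℕ} (hC : 0 < C) (hL : 0 < L)
    (hlow : ∀ x ∈ K, C ≤ |g' x|) (hP : 2 * ε ≤ C * (P * L)) :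
    Cov14 {x ∈ K | |g x| < ε} (P + 1) L := by
  apply Cov14.of_dist hL
  rintro x ⟨hx, hgx⟩ y ⟨hy, hgy⟩ hxy
  rcases hxy.eq_or_lt with rfl | hlt
  · simp; positivity
  have hsub : Set.Icc x y ⊆ K := hK.out hx hy
  obtain ⟨c, hc, hc'⟩ := exists_hasDerivAt_eq_slope g g' hlt
    (fun z hz => (hg z (hsub hz)).continuousAt.continuousWithinAt)
    (fun z hz => hg z (hsub (Set.Ioo_subset_Icc_self hz)))
  have h1 := hlow c (hsub (Set.Ioo_subset_Icc_self hc))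
  have hpos : 0 < y - x := by linarith
  rw [hc', abs_div, abs_of_pos hpos, le_div_iff₀ hpos] at h1
  have h2 : |g y - g x| < 2 * ε := by
    rw [abs_lt] at *
    constructor <;> linarith
  exact le_of_mul_le_mul_left (by linarith) hC

theorem ordConnected_sep14 {h : ℝ → ℝ} {K : Set ℝ} (hK : K.OrdConnected)
    (hm : MonotoneOn h K ∨ AntitoneOn h K) (c : ℝ) :
    ({x ∈ K | c ≤ h x}).OrdConnected ∧ ({x ∈ K | h x ≤ c}).OrdConnected := by
  constructor <;> constructor
  · rintro x ⟨hx, hx'⟩ y ⟨hy, hy'⟩ z hz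
    have hzK := hK.out hx hy hz
    rcases hm with hm | hm
    · exact ⟨hzK, hx'.trans (hm hx hzK hz.1)⟩
    · exact ⟨hzK, hy'.trans (hm hzK hy hz.2)⟩
  · rintro x ⟨hx, hx'⟩ y ⟨hy, hy'⟩ z hz
    have hzK := hK.out hx hy hz
    rcases hm with hm | hm
    · exact ⟨hzK, (hm hzK hy hz.2).trans hy'⟩
    · exact ⟨hzK, (hm hx hzK hz.1).trans hx'⟩

theorem monotone14 {h h' : ℝ → ℝ} {K : Set ℝ} (hK : K.OrdConnected)
    (hd : ∀ x ∈ K, HasDerivAt h (h' x) x) :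
    ((∀ x ∈ K, 0 ≤ h' x) → MonotoneOn h K) ∧ ((∀ x ∈ K, h' x ≤ 0) → AntitoneOn h K) := by
  constructor <;> intro hs
  · exact monotoneOn_of_hasDerivWithinAt_nonneg hK.convex
      (fun z hz => (hd z hz).continuousAt.continuousWithinAt)
      (fun z hz => (hd z (interior_subset hz)).hasDerivWithinAt)
      (fun z hz => hs z (interior_subset hz))
  · exact antitoneOn_of_hasDerivWithinAt_nonpos hK.convex
      (fun z hz => (hd z hz).continuousAt.continuousWithinAt)
      (fun z hz => (hd z (interior_subset hz)).hasDerivWithinAt)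
      (fun z hz => hs z (interior_subset hz))

/-- A function with nonvanishing `(m+1)`-st derivative is piecewise monotone. -/
theorem Cov14.piecewise (m : ℕ) : ∀ (h : ℕ → ℝ → ℝ) (J T : Set ℝ) (N : ℕ) (L : ℝ),
    J.OrdConnected → (∀ k ≤ m, ∀ x ∈ J, HasDerivAt (h k) (h (k + 1) x) x) →
    (∀ x ∈ J, h (m + 1) x ≠ 0) →
    (∀ K ⊆ J, K.OrdConnected → (MonotoneOn (h 0) K ∨ AntitoneOn (h 0) K) →
      Cov14 (K ∩ T) N L) → Cov14 (J ∩ T) (2 ^ m * N) L := by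
  induction m with
  | zero =>
    intro h J T N L hJ hd hne hcov
    simp only [pow_zero, one_mul]
    refine hcov J subset_rfl hJ ?_
    have hd0 := hd 0 le_rfl
    rcases hasDerivWithinAt_forall_lt_or_forall_gt_of_forall_ne hJ.convex
      (fun x hx => (hd0 x hx).hasDerivWithinAt) hne with hs | hs
    · exact Or.inr ((monotone14 hJ hd0).2 fun x hx => (hs x hx).le)
    · exact Or.inl ((monotone14 hJ hd0).1 fun x hx => (hs x hx).le)
  | succ m ih =>
    intro h J T N L hJ hd hne hcov
    have := ih (fun k => h (k + 1)) J T (N + N) L hJ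
      (fun k hk x hx => hd (k + 1) (by omega) x hx) hne ?_
    · exact this.mono subset_rfl (by rw [pow_succ]; apply le_of_eq; ring)
    · intro K hKJ hK hm
      obtain ⟨o1, o2⟩ := ordConnected_sep14 hK hm 0
      have hd0 := hd 0 (by omega)
      have c1 := hcov {x ∈ K | 0 ≤ h 1 x} (fun x hx => hKJ hx.1) o1
        (Or.inl ((monotone14 o1 fun x hx => hd0 x (hKJ hx.1)).1 fun x hx => hx.2))
      have c2 := hcov {x ∈ K | h 1 x ≤ 0} (fun x hx => hKJ hx.1) o2
        (Or.inr ((monotone14 o2 fun x hx => hd0 x (hKJ hx.1)).2 fun x hx => hx.2))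
      refine (c1.union c2).mono ?_ le_rfl
      rintro x ⟨hx, hT⟩
      rcases le_total 0 (h 1 x) with hh | hh
      · exact Or.inl ⟨⟨hx, hh⟩, hT⟩
      · exact Or.inr ⟨⟨hx, hh⟩, hT⟩

/-- Local covering lemma. -/
theorem Cov14.local_cov {g : ℕ → ℝ → ℝ} {J : Set ℝ} (hJ : J.OrdConnected) (n : ℕ)
    (hd : ∀ k < n, ∀ x ∈ J, HasDerivAt (g k) (g (k + 1) x) x)
    {c M A ε η : ℝ} {P : ℕ} (hc : 0 < c) (hM : 0 < M) (hε : 0 < ε) (hη : 0 < η)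
    (hA : ∀ x ∈ J, |g 1 x| ≤ A * M) (hPA : 2 * A ≤ c * P)
    (i : ℕ) (hi : i < n) (hlow : ∀ x ∈ J, c * M ≤ |g (i + 1) x|) :
    Cov14 (J ∩ {x | |g 0 x| < ε ∧ η ≤ |g 1 x|}) (2 ^ n * 6 + P + 1) (ε / η) := by
  have hL : 0 < ε / η := by positivity
  rcases i with _ | i
  · rcases (J ∩ {x | |g 0 x| < ε ∧ η ≤ |g 1 x|}).eq_empty_or_nonempty with he | ⟨x, hx, hx1, hx2⟩
    · rw [he]
      exact ⟨∅, by simp, by simp, by simp⟩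
    have h1 : η ≤ A * M := hx2.trans (hA x hx)
    have := Cov14.of_deriv hJ (hd 0 hi) (C := c * M) (ε := ε) (P := P) (by positivity) hL hlow (by
      rw [mul_div_assoc', mul_div_assoc', le_div_iff₀ hη]
      have h2 : 2 * A * M ≤ c * P * M := mul_le_mul_of_nonneg_right hPA hM.le
      have h3 : 2 * η ≤ c * P * M := by linarith
      have h4 := mul_le_mul_of_nonneg_right h3 hε.le
      linarith)
    exact this.mono (fun y hy => ⟨hy.1, hy.2.1⟩) (by omega)
  · have := Cov14.piecewise i (fun k => g (k + 1)) J {x | |g 0 x| < ε ∧ η ≤ |g 1 x|}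
      ((2 + 1) + (2 + 1)) (ε / η) hJ (fun k hk x hx => hd (k + 1) (by omega) x hx)
      (fun x hx h0 => by
        have := hlow x hx
        rw [h0, abs_zero] at this
        have : 0 < c * M := by positivity
        linarith) ?_
    · refine this.mono subset_rfl ?_
      have : 2 ^ i ≤ 2 ^ n := Nat.pow_le_pow_right (by norm_num) (by omega)
      omega
    · intro K hKJ hK hm
      obtain ⟨o1, -⟩ := ordConnected_sep14 hK hm η
      obtain ⟨-, o2⟩ := ordConnected_sep14 hK hm (-η)
      have hP : 2 * ε ≤ η * (((2 : ℕ) : ℝ) * (ε / η)) := by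
        apply le_of_eq; push_cast; field_simp
      have c1 := Cov14.of_deriv o1 (fun x hx => hd 0 (by omega) x (hKJ hx.1)) (ε := ε) hη hL
        (fun x hx => hx.2.trans (le_abs_self _)) hP
      have c2 := Cov14.of_deriv o2 (fun x hx => hd 0 (by omega) x (hKJ hx.1)) (ε := ε) hη hL
        (fun x hx => le_abs.2 (Or.inr (by have := hx.2; simp at this ⊢; linarith))) hP
      refine (c1.union c2).mono ?_ le_rfl
      rintro x ⟨hx, hx1, hx2⟩
      rcases le_abs.1 hx2 with hh | hh
      · exact Or.inl ⟨⟨hx, hh⟩, hx1⟩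
      · exact Or.inr ⟨⟨hx, by simp; linarith⟩, hx1⟩

theorem stmt14 (n : ℕ) (hn : 1 ≤ n) (I : Set ℝ)
    (F : Set (ℝ → Fin n → ℝ)) (hFfin : F.Finite)
    (hsmooth : ∀ f ∈ F, ∀ j : Fin n, ContDiffOn ℝ n (fun x => f x j) I)
    (ia ib : ℝ) (hab : ia < ib) (I₀ : Set ℝ) (hI₀ : I₀ = Set.Icc ia ib)
    (hsub : I₀ ⊆ I) (c₀ c₁ : ℝ) (hPF : PropertyF F I₀ c₀ c₁)
    (c₂ : ℝ) (hc₂ : 2 * c₂ = c₀ * (c₁ ^ (n - 1))⁻¹ * ((Nat.factorial n : ℝ))⁻¹)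
    (δ₀ : ℝ) (hδ₀pos : 0 < δ₀)
    (hδ₀ : ∀ J : Set ℝ, J.OrdConnected → J ⊆ I₀ → Metric.diam J ≤ δ₀ →
      ∀ f ∈ F, ∀ a : Fin n → ℤ, a ≠ 0 → ∃ i : Fin n, ∀ x ∈ J,
        c₂ * (intMaxAbs a : ℝ) ≤
          |∑ j, (a j : ℝ) * iteratedDeriv (i.1 + 1) (fun y => f y j) x|) :
    ∃ c₃ : ℝ, 0 < c₃ ∧ ∀ f ∈ F, ∀ r ∈ Weights n, ∀ t : ℕ, 1 ≤ t → ∀ ℓ : ℕ,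
      ∀ b : ℝ, 1 < b → ∀ a : Fin n → ℤ, a ≠ 0 → ∀ a₀ : ℤ, ∀ κ : ℝ, 0 < κ → κ < 1 →
      ∃ D : Finset (Set ℝ), (D.card : ℝ) ≤ c₃ ∧
        (∀ Δ ∈ D, ∃ u v : ℝ, Δ = Set.Icc u v ∧
          v - u ≤ κ * b ^ (-(1 + gammaW r) * ((t : ℝ) - (ℓ : ℝ)))) ∧
        {x ∈ I₀ |
          |(a₀ : ℝ) + ∑ j, (a j : ℝ) * f x j| < κ * b ^ (-(t : ℝ)) ∧
          b ^ (gammaW r * (t : ℝ) - (1 + gammaW r) * (ℓ : ℝ)) ≤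
            |∑ j, (a j : ℝ) * deriv (fun y => f y j) x| ∧
          |∑ j, (a j : ℝ) * deriv (fun y => f y j) x| <
            b ^ (gammaW r * (t : ℝ) - (1 + gammaW r) * ((ℓ : ℝ) - 1)) ∧
          ∀ i, |(a i : ℝ)| < b ^ (r i * (t : ℝ))} ⊆ ⋃ Δ ∈ D, Δ := by
  obtain ⟨hc₀, -, hc₁, hF⟩ := hPF
  have hc₂pos : 0 < c₂ := by
    have : 0 < c₀ * (c₁ ^ (n - 1))⁻¹ * ((Nat.factorial n : ℝ))⁻¹ := by positivity
    linarith
  subst hI₀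
  set P : ℕ := ⌈2 * (n * c₁) / c₂⌉₊ with hP
  have hPA : 2 * (n * c₁) ≤ c₂ * P := by
    have := Nat.le_ceil (2 * (n * c₁) / c₂)
    rw [div_le_iff₀ hc₂pos] at this
    linarith
  set Q : ℕ := ⌈(ib - ia) / δ₀⌉₊ with hQ
  refine ⟨(((Q + 1) * (2 ^ n * 6 + P + 1) + 2 : ℕ) : ℝ), by positivity, ?_⟩
  intro f hf r hr t ht ℓ b hb a ha a₀ κ hκ hκ1
  set γ := gammaW r with hγ
  set ε := κ * b ^ (-(t : ℝ)) with hε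
  set η := b ^ (γ * (t : ℝ) - (1 + γ) * (ℓ : ℝ)) with hη
  have hb0 : 0 < b := by linarith
  have hεpos : 0 < ε := by positivity
  have hηpos : 0 < η := by positivity
  have hL : κ * b ^ (-(1 + γ) * ((t : ℝ) - (ℓ : ℝ))) = ε / η := by
    rw [hε, hη, mul_div_assoc, ← Real.rpow_sub hb0]
    congr 2
    ring
  rw [hL]
  set g : ℕ → ℝ → ℝ := fun k x =>
    (if k = 0 then (a₀ : ℝ) else 0) + ∑ j, (a j : ℝ) * iteratedDeriv k (fun y => f y j) x with hg
  have hMpos : 0 < (intMaxAbs a : ℝ) := by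
    obtain ⟨j, hj⟩ := Function.ne_iff.1 ha
    have h1 : (a j).natAbs ≤ intMaxAbs a :=
      Finset.le_sup (f := fun j => (a j).natAbs) (Finset.mem_univ j)
    have h2 : 0 < (a j).natAbs := Int.natAbs_pos.2 hj
    exact_mod_cast h2.trans_le h1
  have hder : ∀ k < n, ∀ x ∈ Set.Ioo ia ib, HasDerivAt (g k) (g (k + 1) x) x := by
    intro k hk x hx
    have h1 : HasDerivAt (fun x => ∑ j, (a j : ℝ) * iteratedDeriv k (fun y => f y j) x)
        (∑ j, (a j : ℝ) * iteratedDeriv (k + 1) (fun y => f y j) x) x := by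
      apply HasDerivAt.fun_sum
      intro j _
      apply HasDerivAt.const_mul
      have hcd : ContDiffAt ℝ n (fun y => f y j) x :=
        (hsmooth f hf j).contDiffAt
          (Filter.mem_of_superset (Icc_mem_nhds hx.1 hx.2) hsub)
      have hdiff : DifferentiableAt ℝ (iteratedDeriv k (fun y => f y j)) x := by
        rw [iteratedDeriv_eq_equiv_comp, LinearIsometryEquiv.comp_differentiableAt_iff]
        exact hcd.differentiableAt_iteratedFDeriv (by exact_mod_cast hk)
      rw [iteratedDeriv_succ]
      exact hdiff.hasDerivAt
    have h2 := h1.const_add (if k = 0 then (a₀ : ℝ) else 0)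
    simpa [hg] using h2
  have hg1 : ∀ x, g 1 x = ∑ j, (a j : ℝ) * deriv (fun y => f y j) x := by
    intro x; simp [hg, iteratedDeriv_one]
  have hg0 : ∀ x, g 0 x = (a₀ : ℝ) + ∑ j, (a j : ℝ) * f x j := by
    intro x; simp [hg, iteratedDeriv_zero]
  have hA : ∀ x ∈ Set.Icc ia ib, |g 1 x| ≤ n * c₁ * (intMaxAbs a : ℝ) := by
    intro x hx
    rw [hg1]
    refine (Finset.abs_sum_le_sum_abs _ _).trans ?_
    have : ∀ j ∈ (Finset.univ : Finset (Fin n)),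
        |(a j : ℝ) * deriv (fun y => f y j) x| ≤ c₁ * (intMaxAbs a : ℝ) := by
      intro j _
      have h1 : (a j).natAbs ≤ intMaxAbs a :=
        Finset.le_sup (f := fun j => (a j).natAbs) (Finset.mem_univ j)
      have h2 : |(a j : ℝ)| ≤ intMaxAbs a := by
        rw [← Int.cast_abs, Int.abs_eq_natAbs]
        exact_mod_cast h1
      have h3 := (((hF f hf x hx).2 j).2 ⟨0, hn⟩).le
      simp only [zero_add, iteratedDeriv_one] at h3
      rw [abs_mul, mul_comm]
      exact mul_le_mul h3 h2 (abs_nonneg _) (by linarith)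
    refine (Finset.sum_le_sum this).trans (le_of_eq ?_)
    simp
    ring
  have hloc : ∀ k ∈ Finset.range (Q + 1),
      Cov14 ((Set.Ioo ia ib ∩ Set.Icc (ia + k * δ₀) (ia + (k + 1) * δ₀)) ∩
        {x | |g 0 x| < ε ∧ η ≤ |g 1 x|}) (2 ^ n * 6 + P + 1) (ε / η) := by
    intro k _
    set J := Set.Ioo ia ib ∩ Set.Icc (ia + k * δ₀) (ia + (k + 1) * δ₀) with hJ
    have hJo : J.OrdConnected := Set.ordConnected_Ioo.inter Set.ordConnected_Icc
    have hJsub : J ⊆ Set.Icc ia ib := fun x hx => Set.Ioo_subset_Icc_self hx.1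
    have hdiam : Metric.diam J ≤ δ₀ := by
      refine (Metric.diam_mono Set.inter_subset_right (Metric.isBounded_Icc _ _)).trans ?_
      rw [Real.diam_Icc (by linarith)]
      linarith
    obtain ⟨i, hi⟩ := hδ₀ J hJo hJsub hdiam f hf a ha
    refine Cov14.local_cov hJo n (fun k hk x hx => hder k hk x hx.1) hc₂pos hMpos hεpos hηpos
      (fun x hx => hA x (hJsub hx)) hPA i.1 i.2 ?_
    intro x hx
    simpa [hg] using hi x hx
  have hmid := Cov14.biUnion _ _ hloc
  have hLpos : 0 ≤ ε / η := by positivity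
  have hall := hmid.union ((Cov14.Icc ia ia (by simpa using hLpos)).union
    (Cov14.Icc ib ib (by simpa using hLpos)))
  obtain ⟨D, h1, h2, h3⟩ := hall
  refine ⟨D, ?_, h2, ?_⟩
  · rw [Finset.card_range] at h1
    exact_mod_cast h1
  refine subset_trans ?_ h3
  rintro x ⟨hx, hx0, hx1, -, -⟩
  rcases hx.1.eq_or_lt with he | hlt
  · right; left; simp [he]
  rcases hx.2.eq_or_lt with he | hlt'
  · right; right; simp [he]
  left
  simp only [Set.mem_iUnion, Finset.mem_range]
  have h0 : 0 ≤ (x - ia) / δ₀ := div_nonneg (by linarith) hδ₀pos.le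
  have e : (x - ia) / δ₀ * δ₀ = x - ia := by field_simp
  refine ⟨⌊(x - ia) / δ₀⌋₊, ?_, ⟨⟨hlt, hlt'⟩, ?_, ?_⟩, ?_, ?_⟩
  · rw [Nat.lt_succ_iff]
    have h4 : (x - ia) / δ₀ ≤ (ib - ia) / δ₀ := by gcongr
    exact_mod_cast (Nat.floor_le h0).trans (h4.trans (Nat.le_ceil _))
  · nlinarith [Nat.floor_le h0]
  · nlinarith [Nat.lt_floor_add_one ((x - ia) / δ₀)]
  · rw [hg0]; exact hx0
  · rw [hg1]; exact hx1
end
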